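/- arXiv:2111.03334 — 2 statements merged into one kernel-verified Lean document; each statement's English description precedes it below -/
import Mathlib

section
/- Let p ∈ ℂ[x_1,…,x_n] be an irreducible polynomial dividing f = f_1⋯f_r (so the hypersurface {p = 0} is an irreducible component of the divisor of f), let N_j ∈ ℕ be the multiplicity of p as a factor of f_j for j = 1,…,r, and set m := N_1·a_1 + ⋯ + N_r·a_r. If m ≠ 0, then for every integer c with 1 ≤ c ≤ m the hyperplane H_c := {α ∈ ℂ^r : N_1·α_1 + ⋯ + N_r·α_r + c = 0} is an irreducible component of Z(B_F^a); in particular H_c ⊆ Z(B_F^a) and H_c is maximal among irreducible Zariski-closed subsets of ℂ^r contained in Z(B_F^a). -/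
open MvPolynomial MeasureTheory

noncomputable section

/-- The polynomial ring `K0[x_1,…,x_n,s_1,…,s_r]`, with the `x`-variables indexed by
`Sum.inl` and the `s`-variables indexed by `Sum.inr`. -/
abbrev XS (K0 : Type) [Field K0] (n r : ℕ) : Type := MvPolynomial (Fin n ⊕ Fin r) K0

/-- The fraction field of `K0[x,s]`; the localization `K0[x,s][1/f]` sits inside it, and the
smallest `∇`-stable submodule generated by an element is the same computed in either. -/
abbrev Frac (K0 : Type) [Field K0] (n r : ℕ) : Type := FractionRing (XS K0 n r)

variable (K0 : Type) [Field K0] (n r : ℕ)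

/-- Embedding of `K0[x_1,…,x_n]` into `K0[x,s]`. -/
def px (p : MvPolynomial (Fin n) K0) : XS K0 n r := rename Sum.inl p

/-- Embedding of `K0[s_1,…,s_r]` into `K0[x,s]`. -/
def ps (p : MvPolynomial (Fin r) K0) : XS K0 n r := rename Sum.inr p

/-- The canonical map from `K0[x,s]` to its fraction field. -/
def toF (p : XS K0 n r) : Frac K0 n r := algebraMap _ _ p

/-- The partial derivative `∂/∂x_i`, extended to the fraction field of `K0[x,s]` via the
quotient rule applied to a representative fraction (the formula is independent of the chosen
representative, so this is the unique derivation extending `pderiv (Sum.inl i)`). -/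
def DX (i : Fin n) (q : Frac K0 n r) : Frac K0 n r :=
  let h := IsFractionRing.div_surjective (A := XS K0 n r) q
  (toF K0 n r (pderiv (Sum.inl i) h.choose) * toF K0 n r h.choose_spec.choose -
      toF K0 n r h.choose * toF K0 n r (pderiv (Sum.inl i) h.choose_spec.choose)) /
    toF K0 n r h.choose_spec.choose ^ 2

/-- The logarithmic twist `∑_j s_j · (∂f_j/∂x_i)/f_j` in the fraction field. -/
def twist (f : Fin r → MvPolynomial (Fin n) K0) (i : Fin n) : Frac K0 n r :=
  ∑ j, toF K0 n r (X (Sum.inr j)) * toF K0 n r (px K0 n r (pderiv i (f j))) /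
    toF K0 n r (px K0 n r (f j))

/-- The twisted partial derivative `∇_i(g·F^s) = (∂g/∂x_i + g·∑_j s_j (∂f_j/∂x_i)/f_j)·F^s`,
the formal action of `∂/∂x_i` on `g·f_1^{s_1}⋯f_r^{s_r}`; here `g·F^s` is identified with `g`. -/
def nabla (f : Fin r → MvPolynomial (Fin n) K0) (i : Fin n) (g : Frac K0 n r) : Frac K0 n r :=
  DX K0 n r i g + g * twist K0 n r f i

/-- The element `F^{s+a} = (f_1^{a_1}⋯f_r^{a_r})·F^s`, where `F^s` is identified with `1`. -/
def Fsa (f : Fin r → MvPolynomial (Fin n) K0) (a : Fin r → ℕ) : Frac K0 n r :=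
  toF K0 n r (∏ j, px K0 n r (f j) ^ a j)

/-- The smallest `K0[x,s]`-submodule containing `F^{s+a}` and stable under `∇_1,…,∇_n`,
realizing `𝒟[s]·F^{s+a}`. -/
def Na (f : Fin r → MvPolynomial (Fin n) K0) (a : Fin r → ℕ) :
    Submodule (XS K0 n r) (Frac K0 n r) :=
  sInf {N | Fsa K0 n r f a ∈ N ∧ ∀ i : Fin n, ∀ m ∈ N, nabla K0 n r f i m ∈ N}

/-- The Bernstein–Sato ideal `B_F^a = { b ∈ K0[s] : b·F^s ∈ N_a }` (as a set of polynomials). -/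
def BS (f : Fin r → MvPolynomial (Fin n) K0) (a : Fin r → ℕ) : Set (MvPolynomial (Fin r) K0) :=
  {b | toF K0 n r (ps K0 n r b) ∈ Na K0 n r f a}

/-- The zero locus `Z(B_F^a) ⊆ ℂ^r` of the Bernstein–Sato ideal. -/
def ZBS (f : Fin r → MvPolynomial (Fin n) ℂ) (a : Fin r → ℕ) : Set (Fin r → ℂ) :=
  {α | ∀ b ∈ BS ℂ n r f a, eval α b = 0}

end

noncomputable section

/-- A subset of `ℂ^r` is Zariski closed if it is the common zero locus of a set of
polynomials. -/
def zarClosed (r : ℕ) (S : Set (Fin r → ℂ)) : Prop :=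
  ∃ I : Set (MvPolynomial (Fin r) ℂ), S = {α | ∀ p ∈ I, eval α p = 0}

/-- A subset of `ℂ^r` is irreducible (for the Zariski topology) if it is nonempty and is not
covered by two Zariski closed sets unless it is contained in one of them. -/
def irredSet (r : ℕ) (V : Set (Fin r → ℂ)) : Prop :=
  V.Nonempty ∧ ∀ C₁ C₂ : Set (Fin r → ℂ), zarClosed r C₁ → zarClosed r C₂ →
    V ⊆ C₁ ∪ C₂ → (V ⊆ C₁ ∨ V ⊆ C₂)

/-- Evaluation of polynomials at a commuting family in a possibly noncommutative algebra. -/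
theorem exists_algHom_of_commute {K A σ : Type*} [Field K] [Ring A] [Algebra K A] (Y : σ → A)
    (hY : ∀ i j, Commute (Y i) (Y j)) :
    ∃ η : MvPolynomial σ K →ₐ[K] A, ∀ i, η (X i) = Y i := by
  have := Algebra.isMulCommutative_adjoin (R := K) (s := Set.range Y) (by
    rintro _ ⟨i, rfl⟩ _ ⟨j, rfl⟩
    exact hY i j)
  let _ : CommRing (Algebra.adjoin K (Set.range Y)) :=
    { (Algebra.adjoin K (Set.range Y)).toRing with mul_comm := this.is_comm.comm }
  let y : σ → Algebra.adjoin K (Set.range Y) := fun i => ⟨Y i, Algebra.subset_adjoin ⟨i, rfl⟩⟩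
  let e : MvPolynomial σ K →ₐ[K] Algebra.adjoin K (Set.range Y) := aeval y
  refine ⟨(Algebra.adjoin K (Set.range Y)).val.comp e, fun i => ?_⟩
  simp [e, y]

/-- If `[Z, Y j] = ε δ_{ij}`, then `[Z, p(Y)] = ε ∂_i p(Y)`. -/
theorem commutator_algHom_eq_pderiv {K A σ : Type*} [Field K] [Ring A] [Algebra K A]
    [DecidableEq σ] (η : MvPolynomial σ K →ₐ[K] A) (Z : A) (ε : K) (i : σ)
    (h : ∀ j, Z * η (X j) - η (X j) * Z = if i = j then algebraMap K A ε else 0)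
    (p : MvPolynomial σ K) : Z * η p - η p * Z = ε • η (pderiv i p) := by
  induction p using MvPolynomial.induction_on with
  | C a =>
    have : η (C a) = algebraMap K A a := η.commutes a
    rw [pderiv_C, map_zero, smul_zero, this, Algebra.commutes, sub_self]
  | add p q hp hq =>
    rw [map_add, map_add, map_add, smul_add, ← hp, ← hq]; noncomm_ring
  | mul_X p j hp =>
    have h1 : Z * η (p * X j) - η (p * X j) * Z =
        (Z * η p - η p * Z) * η (X j) + η p * (Z * η (X j) - η (X j) * Z) := by
      rw [map_mul]; noncomm_ring
    rw [h1, hp, h j, pderiv_mul, map_add, smul_add, map_mul, smul_mul_assoc]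
    congr 1
    split_ifs with hij
    · subst hij
      rw [pderiv_X_self, mul_one, ← Algebra.commutes, Algebra.smul_def]
    · rw [pderiv_X_of_ne (Ne.symm hij)]; simp

/-- A polynomial all of whose partial derivatives vanish is constant, in characteristic zero. -/
theorem eq_C_of_pderiv_eq_zero {K σ : Type*} [Field K] [CharZero K] (p : MvPolynomial σ K)
    (h : ∀ i, pderiv i p = 0) : p = C (coeff 0 p) := by
  classical
  ext m
  rw [coeff_C]
  split_ifs with hm
  · rw [hm]
  · obtain ⟨i, hi⟩ : ∃ i, m i ≠ 0 := by
      by_contra! hc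
      exact hm (Finsupp.ext fun i => (hc i).symm)
    have h1 := coeff_pderiv (i := i) p (m - Finsupp.single i 1)
    rw [h i, coeff_zero] at h1
    have h2 : m - Finsupp.single i 1 + Finsupp.single i 1 = m :=
      tsub_add_cancel_of_le (by simpa [Nat.one_le_iff_ne_zero] using hi)
    rw [h2] at h1
    exact (mul_eq_zero.1 h1.symm).resolve_right (Nat.cast_add_one_ne_zero _)

theorem totalDegree_pderiv_le_sub_one {K σ : Type*} [Field K] (p : MvPolynomial σ K) (i : σ) :
    (pderiv i p).totalDegree ≤ p.totalDegree - 1 := by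
  classical
  refine Finset.sup_le fun m hm => ?_
  rw [mem_support_iff, coeff_pderiv] at hm
  have h := le_totalDegree (mem_support_iff.2 (left_ne_zero_of_mul hm))
  rw [Finsupp.sum_add_index' (fun _ => rfl) (fun _ _ _ => rfl),
    Finsupp.sum_single_index rfl] at h
  exact Nat.le_sub_of_add_le h

/-- The ordered evaluation `x^α y^β ↦ X^α Y^β`. -/
def normalOrder {K A σ : Type*} [Field K] [Ring A] [Algebra K A]
    (ηX ηY : MvPolynomial σ K →ₐ[K] A) : MvPolynomial (σ ⊕ σ) K →ₗ[K] A :=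
  (basisMonomials (σ ⊕ σ) K).constr K fun γ =>
    ηX (monomial (Finsupp.sumFinsuppEquivProdFinsupp γ).1 1) *
      ηY (monomial (Finsupp.sumFinsuppEquivProdFinsupp γ).2 1)

theorem normalOrder_monomial {K A σ : Type*} [Field K] [Ring A] [Algebra K A]
    (ηX ηY : MvPolynomial σ K →ₐ[K] A) (γ : σ ⊕ σ →₀ ℕ) (c : K) :
    normalOrder ηX ηY (monomial γ c) =
      ηX (monomial (Finsupp.sumFinsuppEquivProdFinsupp γ).1 1) *
      ηY (monomial (Finsupp.sumFinsuppEquivProdFinsupp γ).2 c) := by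
  have h : (monomial γ c : MvPolynomial (σ ⊕ σ) K) = c • basisMonomials (σ ⊕ σ) K γ := by
    simp [smul_monomial]
  rw [h, map_smul, normalOrder, Module.Basis.constr_basis, ← mul_smul_comm, ← map_smul,
    smul_monomial, smul_eq_mul, mul_one]

theorem normalOrder_monomial' {K A σ : Type*} [Field K] [Ring A] [Algebra K A]
    (ηX ηY : MvPolynomial σ K →ₐ[K] A) (γ : σ ⊕ σ →₀ ℕ) (c : K) :
    normalOrder ηX ηY (monomial γ c) =
      ηX (monomial (Finsupp.sumFinsuppEquivProdFinsupp γ).1 c) *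
      ηY (monomial (Finsupp.sumFinsuppEquivProdFinsupp γ).2 1) := by
  have h : (monomial γ c : MvPolynomial (σ ⊕ σ) K) = c • basisMonomials (σ ⊕ σ) K γ := by
    simp [smul_monomial]
  rw [h, map_smul, normalOrder, Module.Basis.constr_basis, ← smul_mul_assoc, ← map_smul,
    smul_monomial, smul_eq_mul, mul_one]

theorem commutator_normalOrder_inr {K A σ : Type*} [Field K] [Ring A] [Algebra K A]
    [DecidableEq σ] (ηX ηY : MvPolynomial σ K →ₐ[K] A)
    (h : ∀ i j, ηY (X i) * ηX (X j) - ηX (X j) * ηY (X i) = if i = j then 1 else 0)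
    (i : σ) (p : MvPolynomial (σ ⊕ σ) K) :
    normalOrder ηX ηY p * ηX (X i) - ηX (X i) * normalOrder ηX ηY p =
      normalOrder ηX ηY (pderiv (Sum.inr i) p) := by
  have hcX : ∀ q, ηX q * ηX (X i) = ηX (X i) * ηX q := fun q => by
    rw [← map_mul, ← map_mul, mul_comm]
  induction p using MvPolynomial.induction_on' with
  | add p q hp hq =>
    rw [map_add, map_add, map_add, ← hp, ← hq]; noncomm_ring
  | monomial γ c =>
    rw [pderiv_monomial, normalOrder_monomial, normalOrder_monomial]
    have h1 := commutator_algHom_eq_pderiv ηY (ηX (X i)) (-1) i (fun j => by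
      rw [← neg_sub, h j i]
      by_cases hij : i = j
      · simp [hij]
      · simp [hij, Ne.symm hij]) (monomial (Finsupp.sumFinsuppEquivProdFinsupp γ).2 c)
    rw [mul_assoc, ← mul_assoc (ηX (X i)), ← hcX, mul_assoc, ← mul_sub, ← neg_sub, h1,
      pderiv_monomial, neg_smul, one_smul, neg_neg]
    congr 4
    · ext j
      simp
    · ext j
      by_cases hij : i = j
      · simp [hij]
      · simp [hij]

theorem commutator_normalOrder_inl {K A σ : Type*} [Field K] [Ring A] [Algebra K A]
    [DecidableEq σ] (ηX ηY : MvPolynomial σ K →ₐ[K] A)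
    (h : ∀ i j, ηY (X i) * ηX (X j) - ηX (X j) * ηY (X i) = if i = j then 1 else 0)
    (i : σ) (p : MvPolynomial (σ ⊕ σ) K) :
    ηY (X i) * normalOrder ηX ηY p - normalOrder ηX ηY p * ηY (X i) =
      normalOrder ηX ηY (pderiv (Sum.inl i) p) := by
  have hcY : ∀ q, ηY q * ηY (X i) = ηY (X i) * ηY q := fun q => by
    rw [← map_mul, ← map_mul, mul_comm]
  induction p using MvPolynomial.induction_on' with
  | add p q hp hq =>
    rw [map_add, map_add, map_add, ← hp, ← hq]; noncomm_ring
  | monomial γ c =>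
    rw [pderiv_monomial, normalOrder_monomial', normalOrder_monomial']
    have h1 := commutator_algHom_eq_pderiv ηX (ηY (X i)) 1 i (fun j => by
      rw [h i j, map_one]) (monomial (Finsupp.sumFinsuppEquivProdFinsupp γ).1 c)
    rw [mul_assoc, hcY, ← mul_assoc, ← mul_assoc, ← sub_mul, h1, pderiv_monomial, one_smul]
    congr 4
    · ext j
      by_cases hij : i = j
      · simp [hij]
      · simp [hij]
    · ext j
      simp

/-- A monomial in operators raising a filtration by one step raises it by its degree. -/
theorem algHom_monomial_mem {K V σ : Type*} [Field K] [AddCommGroup V] [Module K V]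
    (η : MvPolynomial σ K →ₐ[K] Module.End K V) (S : ℕ → Submodule K V)
    (hS : ∀ i k, ∀ v ∈ S k, η (X i) v ∈ S (k + 1)) (γ : σ →₀ ℕ) :
    ∀ k, ∀ v ∈ S k, η (monomial γ 1) v ∈ S (k + γ.degree) := by
  induction γ using Finsupp.induction_linear with
  | zero => 
    intro k v hv
    have : (monomial (0 : σ →₀ ℕ) (1 : K)) = 1 := rfl
    simpa [this] using hv
  | add f g hf hg =>
    intro k v hv
    rw [← one_mul (1 : K), ← monomial_mul, map_mul, Module.End.mul_apply, map_add,
      add_comm _ g.degree,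
      ← add_assoc]
    exact hf _ _ (hg _ _ hv)
  | single i e =>
    induction e with
    | zero =>
      intro k v hv
      have : (monomial (0 : σ →₀ ℕ) (1 : K)) = 1 := rfl
      simpa [this] using hv
    | succ e ih =>
      intro k v hv
      rw [Finsupp.single_add, ← one_mul (1 : K), ← monomial_mul, map_mul, Module.End.mul_apply,
        map_add, add_comm _ (Finsupp.degree (Finsupp.single i 1)), ← add_assoc]
      refine ih _ _ ?_
      rw [Finsupp.degree_single]
      exact hS i k v hv

theorem normalOrder_injective_on_filtration {K V σ : Type*} [Field K] [CharZero K] [AddCommGroup V]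
    [Module K V] [DecidableEq σ] (ηX ηY : MvPolynomial σ K →ₐ[K] Module.End K V)
    (h : ∀ i j, ηY (X i) * ηX (X j) - ηX (X j) * ηY (X i) = if i = j then 1 else 0)
    (S : ℕ → Submodule K V) (hmono : Monotone S)
    (hSX : ∀ i k, ∀ v ∈ S k, ηX (X i) v ∈ S (k + 1))
    (hSY : ∀ i k, ∀ v ∈ S k, ηY (X i) v ∈ S (k + 1))
    (q : V) (hq : q ∈ S 0) (hq0 : q ≠ 0) (j : ℕ) :
    ∀ p : MvPolynomial (σ ⊕ σ) K, p.totalDegree ≤ j →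
      (∀ v ∈ S j, normalOrder ηX ηY p v = 0) → p = 0 := by
  have hconst : ∀ (c : K) (k : ℕ), (∀ v ∈ S k, normalOrder ηX ηY (C c) v = 0) → c = 0 := by
    intro c k hc
    have h1 := hc q (hmono (Nat.zero_le k) hq)
    rw [← monomial_zero', normalOrder_monomial] at h1
    have h2 : ηY (monomial (0 : σ →₀ ℕ) c) = algebraMap K _ c := ηY.commutes c
    have h3 : ηX (monomial (0 : σ →₀ ℕ) (1 : K)) = 1 := map_one ηX
    have h4 : (Finsupp.sumFinsuppEquivProdFinsupp (0 : σ ⊕ σ →₀ ℕ)) = 0 := by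
      ext <;> simp
    rw [h4, Prod.fst_zero, Prod.snd_zero, h2, h3, one_mul, Module.algebraMap_end_apply] at h1
    exact (smul_eq_zero.1 h1).resolve_right hq0
  induction j with
  | zero =>
    intro p hp hv
    rw [totalDegree_eq_zero_iff_eq_C.1 (Nat.le_zero.1 hp)] at hv ⊢
    rw [hconst _ _ hv, C_0]
  | succ j ih =>
    intro p hp hv
    have hder : ∀ i, pderiv i p = 0 := by
      intro i
      refine ih _ ((totalDegree_pderiv_le_sub_one p i).trans (by omega)) fun v hvj => ?_
      have hvj' := hmono (Nat.le_succ j) hvj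
      rcases i with i | i
      · rw [← commutator_normalOrder_inl ηX ηY h, LinearMap.sub_apply, Module.End.mul_apply,
          Module.End.mul_apply, hv v hvj', hv _ (hSY i j v hvj), map_zero, sub_zero]
      · rw [← commutator_normalOrder_inr ηX ηY h, LinearMap.sub_apply, Module.End.mul_apply,
          Module.End.mul_apply, hv v hvj', hv _ (hSX i j v hvj), map_zero, sub_zero]
    rw [eq_C_of_pderiv_eq_zero p hder] at hv ⊢
    rw [hconst _ _ hv, C_0]

/-- The Bernstein inequality: a nonzero filtered module over the `n`-th Weyl algebra grows at least
like `k ^ n`. -/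
theorem pow_le_finrank_of_weyl {K V : Type*} [Field K] [CharZero K] [AddCommGroup V] [Module K V]
    {n : ℕ} (P Q : Fin n → Module.End K V) (hP : ∀ i j, Commute (P i) (P j))
    (hQ : ∀ i j, Commute (Q i) (Q j))
    (h : ∀ i j, Q i * P j - P j * Q i = if i = j then 1 else 0)
    (S : ℕ → Submodule K V) (hmono : Monotone S) (hfin : ∀ k, FiniteDimensional K (S k))
    (hSP : ∀ i k, ∀ v ∈ S k, P i v ∈ S (k + 1)) (hSQ : ∀ i k, ∀ v ∈ S k, Q i v ∈ S (k + 1))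
    (q : V) (hq : q ∈ S 0) (hq0 : q ≠ 0) (k : ℕ) :
    (k + 1) ^ n ≤ Module.finrank K (S (4 * n * k)) := by
  obtain ⟨ηX, hηX⟩ := exists_algHom_of_commute (K := K) P hP
  obtain ⟨ηY, hηY⟩ := exists_algHom_of_commute (K := K) Q hQ
  simp only [← hηX, ← hηY] at h hSP hSQ
  have hdeg : ∀ γ : Fin n ⊕ Fin n →₀ ℕ, γ.degree =
      (Finsupp.sumFinsuppEquivProdFinsupp γ).1.degree +
        (Finsupp.sumFinsuppEquivProdFinsupp γ).2.degree := by
    intro γ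
    simp [Finsupp.degree_eq_sum]
  have hmem : ∀ p : MvPolynomial (Fin n ⊕ Fin n) K, p.totalDegree ≤ 2 * n * k →
      ∀ v ∈ S (2 * n * k), normalOrder ηX ηY p v ∈ S (4 * n * k) := by
    intro p hp v hv
    rw [p.as_sum, map_sum, LinearMap.sum_apply]
    refine Submodule.sum_mem _ fun γ hγ => ?_
    have h1 : (monomial γ (coeff γ p) : MvPolynomial (Fin n ⊕ Fin n) K) =
        coeff γ p • monomial γ 1 := by rw [smul_monomial, smul_eq_mul, mul_one]
    rw [h1, map_smul, LinearMap.smul_apply, normalOrder_monomial, Module.End.mul_apply]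
    refine Submodule.smul_mem _ _ (hmono ?_ (algHom_monomial_mem ηX S hSP _ _ _
      (algHom_monomial_mem ηY S hSQ _ _ _ hv)))
    have h2 : γ.degree ≤ 2 * n * k := (le_totalDegree hγ).trans hp
    rw [hdeg] at h2
    linarith
  let B := restrictTotalDegree (Fin n ⊕ Fin n) K (2 * n * k)
  let Φ : B →ₗ[K] (S (2 * n * k) →ₗ[K] S (4 * n * k)) :=
    { toFun := fun p => ((normalOrder ηX ηY p.1).domRestrict _).codRestrict _
        fun v => hmem p.1 ((mem_restrictTotalDegree _ _ _).1 p.2) v.1 v.2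
      map_add' := fun p q => by ext v; simp; rfl
      map_smul' := fun c p => by ext v; simp; rfl }
  have hΦ : Function.Injective Φ := by
    rw [injective_iff_map_eq_zero]
    intro p hp
    refine Subtype.ext (normalOrder_injective_on_filtration ηX ηY h S hmono hSP hSQ q hq hq0
      (2 * n * k) p.1 ((mem_restrictTotalDegree _ _ _).1 p.2) fun v hv => ?_)
    exact congrArg Subtype.val (LinearMap.congr_fun hp ⟨v, hv⟩)
  let g : (Fin n ⊕ Fin n → Fin (k + 1)) → (Fin n ⊕ Fin n →₀ ℕ) :=
    fun e => Finsupp.equivFunOnFinite.symm fun i => (e i : ℕ)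
  have hg : Function.Injective g := by
    intro e e' hee
    funext i
    exact Fin.ext (by simpa [g] using DFunLike.congr_fun hee i)
  let b : (Fin n ⊕ Fin n → Fin (k + 1)) → B := fun e =>
    ⟨monomial (g e) 1, (mem_restrictTotalDegree _ _ _).2 <| by
      refine (totalDegree_monomial_le _ _).trans ?_
      change (g e).degree ≤ _
      rw [Finsupp.degree_eq_sum]
      refine (Finset.sum_le_card_nsmul _ _ k fun i _ => ?_).trans ?_
      · simpa [g] using Nat.lt_succ_iff.1 (e i).2
      · simp [two_mul]⟩
  have hb : LinearIndependent K b := by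
    refine LinearIndependent.of_comp B.subtype ?_
    have := ((basisMonomials (Fin n ⊕ Fin n) K).linearIndependent).comp g hg
    rw [coe_basisMonomials] at this
    exact this
  have h1 := (hb.map' Φ (LinearMap.ker_eq_bot.2 hΦ)).fintype_card_le_finrank
  rw [Module.finrank_linearMap] at h1
  have h2 : Module.finrank K (S (2 * n * k)) ≤ Module.finrank K (S (4 * n * k)) :=
    Submodule.finrank_mono (hmono (by nlinarith [Nat.zero_le (n * k)]))
  have h3 : ((k + 1) ^ n) ^ 2 ≤ Module.finrank K (S (4 * n * k)) ^ 2 := by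
    calc ((k + 1) ^ n) ^ 2 = Fintype.card (Fin n ⊕ Fin n → Fin (k + 1)) := by
          simp; ring
      _ ≤ _ := h1
      _ ≤ _ := by rw [sq]; exact Nat.mul_le_mul_right _ h2
  exact (Nat.pow_le_pow_iff_left two_ne_zero).1 h3

/-- A descending chain of submodules over the Weyl algebra, generated in a filtration of growth
at most `(v * D + 1) ^ n`, has a repetition. -/
theorem exists_mem_succ_of_weyl_chain {K V : Type*} [Field K] [CharZero K] [AddCommGroup V]
    [Module K V] {n : ℕ} (P Q : Fin n → Module.End K V) (hP : ∀ i j, Commute (P i) (P j))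
    (hQ : ∀ i j, Commute (Q i) (Q j))
    (h : ∀ i j, Q i * P j - P j * Q i = if i = j then 1 else 0)
    (Γ : ℕ → Submodule K V) (hmono : Monotone Γ) (hfin : ∀ k, FiniteDimensional K (Γ k))
    (hΓP : ∀ i k, ∀ v ∈ Γ k, P i v ∈ Γ (k + 1)) (hΓQ : ∀ i k, ∀ v ∈ Γ k, Q i v ∈ Γ (k + 1))
    (D : ℕ) (hD : ∀ v, Module.finrank K (Γ v) ≤ (v * D + 1) ^ n)
    (L : ℕ → Submodule K V) (hL : Antitone L) (hLP : ∀ k i, ∀ v ∈ L k, P i v ∈ L k)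
    (hLQ : ∀ k i, ∀ v ∈ L k, Q i v ∈ L k) (q : ℕ → V) (hqL : ∀ k, q k ∈ L k)
    (hqΓ : ∀ k, ∃ v, q k ∈ Γ v) : ∃ k, q k ∈ L (k + 1) := by
  by_contra! hcon
  choose w hw using hqΓ
  set A := (4 * n + 1) * D + 1
  set l := A ^ n + 1
  set v₀ := ∑ k ∈ Finset.range l, w k
  have hqv : ∀ k < l, q k ∈ Γ v₀ := fun k hk =>
    hmono (Finset.single_le_sum (f := w) (fun _ _ => Nat.zero_le _) (Finset.mem_range.2 hk)) (hw k)
  have hstep : ∀ k < l, ∀ t, (t + 1) ^ n + Module.finrank K ↥(Γ (v₀ + 4 * n * t) ⊓ L (k + 1)) ≤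
      Module.finrank K ↥(Γ (v₀ + 4 * n * t) ⊓ L k) := by
    intro k hk t
    let N := L (k + 1)
    let P' : Fin n → Module.End K (V ⧸ N) := fun i => N.mapQ N (P i) fun v hv => hLP _ i v hv
    let Q' : Fin n → Module.End K (V ⧸ N) := fun i => N.mapQ N (Q i) fun v hv => hLQ _ i v hv
    let S : ℕ → Submodule K (V ⧸ N) := fun j => (Γ (v₀ + j) ⊓ L k).map N.mkQ
    have hb := pow_le_finrank_of_weyl P' Q'
      (fun i j => by
        refine LinearMap.ext fun x => ?_
        obtain ⟨x, rfl⟩ := N.mkQ_surjective x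
        exact congrArg N.mkQ (LinearMap.congr_fun (hP i j) x))
      (fun i j => by
        refine LinearMap.ext fun x => ?_
        obtain ⟨x, rfl⟩ := N.mkQ_surjective x
        exact congrArg N.mkQ (LinearMap.congr_fun (hQ i j) x))
      (fun i j => by
        refine LinearMap.ext fun x => ?_
        obtain ⟨x, rfl⟩ := N.mkQ_surjective x
        have := congrArg N.mkQ (LinearMap.congr_fun (h i j) x)
        split_ifs at this ⊢
        · exact this
        · exact this)
      S (fun i j hij => Submodule.map_mono (inf_le_inf_right _ (hmono (by omega))))
      (fun j => by
        have := hfin (v₀ + j)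
        have : FiniteDimensional K ↥(Γ (v₀ + j) ⊓ L k) :=
          Submodule.finiteDimensional_of_le inf_le_left
        exact Module.Finite.map _ _)
      (by
        rintro i j _ ⟨v, ⟨hv, hv'⟩, rfl⟩
        exact ⟨P i v, ⟨hΓP i _ v hv, hLP k i v hv'⟩, rfl⟩)
      (by
        rintro i j _ ⟨v, ⟨hv, hv'⟩, rfl⟩
        exact ⟨Q i v, ⟨hΓQ i _ v hv, hLQ k i v hv'⟩, rfl⟩)
      (N.mkQ (q k)) ⟨q k, ⟨hqv k hk, hqL k⟩, rfl⟩
      (by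
        rw [ne_eq, Submodule.mkQ_apply, Submodule.Quotient.mk_eq_zero]
        exact hcon k) t
    have := hfin (v₀ + 4 * n * t)
    have : FiniteDimensional K ↥(Γ (v₀ + 4 * n * t) ⊓ L k) :=
      Submodule.finiteDimensional_of_le inf_le_left
    have hr := (N.mkQ.domRestrict (Γ (v₀ + 4 * n * t) ⊓ L k)).finrank_range_add_finrank_ker
    rw [LinearMap.range_domRestrict] at hr
    rw [← hr]
    refine Nat.add_le_add hb (le_of_eq ?_)
    rw [LinearMap.ker_domRestrict, Submodule.ker_mkQ]
    have hle : Γ (v₀ + 4 * n * t) ⊓ N ≤ Γ (v₀ + 4 * n * t) ⊓ L k :=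
      inf_le_inf_left _ (hL (Nat.le_succ k))
    rw [← (Submodule.submoduleOfEquivOfLe hle).finrank_eq]
    have hcomap : (Γ (v₀ + 4 * n * t) ⊓ N).submoduleOf (Γ (v₀ + 4 * n * t) ⊓ L k) =
        Submodule.comap (Γ (v₀ + 4 * n * t) ⊓ L k).subtype N :=
      Submodule.ext fun v => ⟨fun hv => hv.2, fun hv => ⟨v.2.1, hv⟩⟩
    rw [hcomap]
  have hsum : ∀ j ≤ l, ∀ t, j * (t + 1) ^ n +
      Module.finrank K ↥(Γ (v₀ + 4 * n * t) ⊓ L j) ≤ Module.finrank K (Γ (v₀ + 4 * n * t)) := by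
    intro j
    induction j with
    | zero =>
      intro _ t
      have := hfin (v₀ + 4 * n * t)
      rw [zero_mul, zero_add]
      exact Submodule.finrank_mono inf_le_left
    | succ j ih =>
      intro hj t
      have h1 := ih (by omega) t
      have h2 := hstep j (by omega) t
      rw [add_one_mul]
      omega
  have h1 := (Nat.le_add_right _ _).trans ((hsum l le_rfl v₀).trans (hD _))
  have h2 : ((v₀ + 4 * n * v₀) * D + 1) ^ n ≤ A ^ n * (v₀ + 1) ^ n := by
    rw [← mul_pow]
    refine Nat.pow_le_pow_left ?_ n
    simp only [A]
    nlinarith [Nat.zero_le (n * D), Nat.zero_le D, Nat.zero_le v₀]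
  have h3 : 0 < (v₀ + 1) ^ n := by positivity
  have h4 : l * (v₀ + 1) ^ n = A ^ n * (v₀ + 1) ^ n + (v₀ + 1) ^ n := add_one_mul _ _
  omega

section DifferentialCalculus

variable {K0 : Type} [Field K0] {n r : ℕ}

theorem toF_injective : Function.Injective (toF K0 n r) :=
  IsFractionRing.injective (XS K0 n r) (Frac K0 n r)

theorem toF_ne_zero {A : XS K0 n r} (hA : A ≠ 0) : toF K0 n r A ≠ 0 :=
  fun h => hA (toF_injective (h.trans (map_zero (algebraMap (XS K0 n r) (Frac K0 n r))).symm))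

theorem toF_add (A B : XS K0 n r) : toF K0 n r (A + B) = toF K0 n r A + toF K0 n r B :=
  map_add _ _ _

theorem toF_sub (A B : XS K0 n r) : toF K0 n r (A - B) = toF K0 n r A - toF K0 n r B :=
  map_sub _ _ _

theorem toF_mul (A B : XS K0 n r) : toF K0 n r (A * B) = toF K0 n r A * toF K0 n r B :=
  map_mul _ _ _

theorem toF_pow (A : XS K0 n r) (k : ℕ) : toF K0 n r (A ^ k) = toF K0 n r A ^ k :=
  map_pow _ _ _

theorem toF_one : toF K0 n r 1 = 1 := map_one _

theorem toF_zero : toF K0 n r 0 = 0 := map_zero _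

theorem smul_eq_toF_mul (A : XS K0 n r) (q : Frac K0 n r) : A • q = toF K0 n r A * q :=
  Algebra.smul_def _ _

theorem px_ne_zero {p : MvPolynomial (Fin n) K0} (hp : p ≠ 0) : px K0 n r p ≠ 0 :=
  fun h => hp (rename_injective _ Sum.inl_injective (h.trans (map_zero _).symm))

theorem ps_ne_zero {p : MvPolynomial (Fin r) K0} (hp : p ≠ 0) : ps K0 n r p ≠ 0 :=
  fun h => hp (rename_injective _ Sum.inr_injective (h.trans (map_zero _).symm))

theorem exists_eq_toF_div (q : Frac K0 n r) :
    ∃ A B : XS K0 n r, B ≠ 0 ∧ q = toF K0 n r A / toF K0 n r B := by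
  obtain ⟨A, B, hB, h⟩ := IsFractionRing.div_surjective (A := XS K0 n r) q
  exact ⟨A, B, nonZeroDivisors.ne_zero hB, h.symm⟩

theorem DX_div (i : Fin n) (A B : XS K0 n r) (hB : B ≠ 0) :
    DX K0 n r i (toF K0 n r A / toF K0 n r B) =
      (toF K0 n r (pderiv (Sum.inl i) A) * toF K0 n r B -
        toF K0 n r A * toF K0 n r (pderiv (Sum.inl i) B)) / toF K0 n r B ^ 2 := by
  have h := IsFractionRing.div_surjective (A := XS K0 n r) (toF K0 n r A / toF K0 n r B)
  have key : ∀ A₀ B₀ : XS K0 n r, B₀ ∈ nonZeroDivisors (XS K0 n r) →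
      toF K0 n r A₀ / toF K0 n r B₀ = toF K0 n r A / toF K0 n r B →
      (toF K0 n r (pderiv (Sum.inl i) A₀) * toF K0 n r B₀ -
        toF K0 n r A₀ * toF K0 n r (pderiv (Sum.inl i) B₀)) / toF K0 n r B₀ ^ 2 =
      (toF K0 n r (pderiv (Sum.inl i) A) * toF K0 n r B -
        toF K0 n r A * toF K0 n r (pderiv (Sum.inl i) B)) / toF K0 n r B ^ 2 := by
    intro A₀ B₀ hB₀ heq
    have h0 := toF_ne_zero (nonZeroDivisors.ne_zero hB₀)
    have h1 := toF_ne_zero hB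
    rw [div_eq_div_iff h0 h1] at heq
    have e := toF_injective ((toF_mul _ _).trans (heq.trans (toF_mul _ _).symm))
    have e2 := congrArg (fun P => toF K0 n r (pderiv (Sum.inl i) P)) e
    simp only [pderiv_mul, toF_add, toF_mul] at e2
    rw [div_eq_div_iff (pow_ne_zero 2 h0) (pow_ne_zero 2 h1)]
    linear_combination (toF K0 n r B₀ * toF K0 n r B) * e2 -
      (toF K0 n r (pderiv (Sum.inl i) B₀) * toF K0 n r B +
        toF K0 n r (pderiv (Sum.inl i) B) * toF K0 n r B₀) * heq
  exact key _ _ h.choose_spec.choose_spec.1 h.choose_spec.choose_spec.2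

theorem DX_toF (i : Fin n) (A : XS K0 n r) :
    DX K0 n r i (toF K0 n r A) = toF K0 n r (pderiv (Sum.inl i) A) := by
  have h := DX_div i A 1 one_ne_zero
  simpa [toF_one, toF_zero] using h

theorem DX_add (i : Fin n) (g h : Frac K0 n r) :
    DX K0 n r i (g + h) = DX K0 n r i g + DX K0 n r i h := by
  obtain ⟨A, B, hB, rfl⟩ := exists_eq_toF_div g
  obtain ⟨A', B', hB', rfl⟩ := exists_eq_toF_div h
  have h1 := toF_ne_zero hB
  have h2 := toF_ne_zero hB'
  rw [div_add_div _ _ h1 h2, ← toF_mul, ← toF_mul, ← toF_mul, ← toF_add,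
    DX_div _ _ _ (mul_ne_zero hB hB'),
    DX_div _ _ _ hB, DX_div _ _ _ hB', map_add, pderiv_mul, pderiv_mul, pderiv_mul]
  simp only [toF_add, toF_mul]
  field_simp
  ring

theorem DX_mul (i : Fin n) (g h : Frac K0 n r) :
    DX K0 n r i (g * h) = g * DX K0 n r i h + h * DX K0 n r i g := by
  obtain ⟨A, B, hB, rfl⟩ := exists_eq_toF_div g
  obtain ⟨A', B', hB', rfl⟩ := exists_eq_toF_div h
  have h1 := toF_ne_zero hB
  have h2 := toF_ne_zero hB'
  rw [div_mul_div_comm, ← toF_mul, ← toF_mul, DX_div _ _ _ (mul_ne_zero hB hB'),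
    DX_div _ _ _ hB, DX_div _ _ _ hB', pderiv_mul, pderiv_mul]
  simp only [toF_add, toF_mul]
  field_simp
  ring

variable (K0 n r) in
/-- `DX` as a derivation of the fraction field. -/
def derivX (i : Fin n) : Derivation K0 (Frac K0 n r) (Frac K0 n r) :=
  Derivation.mk'
    { toFun := DX K0 n r i
      map_add' := DX_add i
      map_smul' := fun c g => by
        have h : algebraMap K0 (Frac K0 n r) c = toF K0 n r (C c) :=
          IsScalarTower.algebraMap_apply K0 (XS K0 n r) (Frac K0 n r) c
        rw [Algebra.smul_def, h, DX_mul, DX_toF, pderiv_C, toF_zero, mul_zero, add_zero,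
          RingHom.id_apply, Algebra.smul_def, h] }
    (DX_mul i)

theorem derivX_apply (i : Fin n) (g : Frac K0 n r) : derivX K0 n r i g = DX K0 n r i g := rfl

theorem pderiv_comm' {σ : Type*} (i j : σ) (p : MvPolynomial σ K0) :
    pderiv i (pderiv j p) = pderiv j (pderiv i p) := by
  classical
  let D : σ → Derivation K0 (MvPolynomial σ K0) (MvPolynomial σ K0) := fun i => pderiv i
  have h : ⁅D i, D j⁆ = 0 := by
    refine MvPolynomial.derivation_ext fun k => ?_
    rw [Derivation.commutator_apply]
    simp only [D, pderiv_X, Pi.single_apply]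
    split_ifs <;> simp
  have := DFunLike.congr_fun h p
  rw [Derivation.commutator_apply] at this
  exact sub_eq_zero.1 this

theorem DX_comm (i j : Fin n) (g : Frac K0 n r) :
    DX K0 n r i (DX K0 n r j g) = DX K0 n r j (DX K0 n r i g) := by
  have hD : ∀ A, ⁅derivX K0 n r i, derivX K0 n r j⁆ (toF K0 n r A) = 0 := fun A => by
    rw [Derivation.commutator_apply]
    simp only [derivX_apply, DX_toF]
    rw [pderiv_comm', sub_self]
  obtain ⟨A, B, hB, rfl⟩ := exists_eq_toF_div g
  have h := Derivation.leibniz_div ⁅derivX K0 n r i, derivX K0 n r j⁆ (toF K0 n r A) (toF K0 n r B)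
  rw [hD, hD, smul_zero, smul_zero, sub_zero, smul_zero, Derivation.commutator_apply] at h
  exact sub_eq_zero.1 h

theorem pderiv_px (i : Fin n) (p : MvPolynomial (Fin n) K0) :
    pderiv (Sum.inl i) (px K0 n r p) = px K0 n r (pderiv i p) :=
  pderiv_rename Sum.inl_injective i p

theorem pderiv_ps (i : Fin n) (b : MvPolynomial (Fin r) K0) :
    pderiv (Sum.inl i) (ps K0 n r b) = 0 := by
  classical
  refine pderiv_eq_zero_of_notMem_vars fun h => ?_
  simpa using Finset.mem_of_subset (vars_rename _ _) h

theorem DX_px (i : Fin n) (p : MvPolynomial (Fin n) K0) :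
    DX K0 n r i (toF K0 n r (px K0 n r p)) = toF K0 n r (px K0 n r (pderiv i p)) := by
  rw [DX_toF, pderiv_px]

theorem DX_twist (f : Fin r → MvPolynomial (Fin n) K0) (i j : Fin n) :
    DX K0 n r i (twist K0 n r f j) = DX K0 n r j (twist K0 n r f i) := by
  simp only [twist, ← derivX_apply, map_sum]
  refine Finset.sum_congr rfl fun k _ => ?_
  have hs : ∀ i, derivX K0 n r i (toF K0 n r (X (Sum.inr k))) = 0 := fun i => by
    rw [derivX_apply, DX_toF, pderiv_X_of_ne Sum.inr_ne_inl, toF_zero]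
  simp only [Derivation.leibniz_div, Derivation.leibniz, hs, derivX_apply, DX_px, pderiv_comm' i j,
    smul_eq_mul]
  ring

theorem nabla_add (f : Fin r → MvPolynomial (Fin n) K0) (i : Fin n) (g h : Frac K0 n r) :
    nabla K0 n r f i (g + h) = nabla K0 n r f i g + nabla K0 n r f i h := by
  rw [nabla, nabla, nabla, DX_add]; ring

theorem nabla_mul (f : Fin r → MvPolynomial (Fin n) K0) (i : Fin n) (g h : Frac K0 n r) :
    nabla K0 n r f i (g * h) = DX K0 n r i g * h + g * nabla K0 n r f i h := by
  rw [nabla, nabla, DX_mul]; ring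

theorem nabla_comm (f : Fin r → MvPolynomial (Fin n) K0) (i j : Fin n) (g : Frac K0 n r) :
    nabla K0 n r f i (nabla K0 n r f j g) = nabla K0 n r f j (nabla K0 n r f i g) := by
  simp only [nabla, DX_add, DX_mul]
  rw [DX_comm i j, DX_twist f i j]
  ring

theorem toF_X_inr_eq (j : Fin r) : toF K0 n r (X (Sum.inr j)) = toF K0 n r (ps K0 n r (X j)) := by
  rw [ps, rename_X]

end DifferentialCalculus

section BernsteinModule

variable {K0 : Type} [Field K0] {n r : ℕ}

theorem Fsa_mem_Na (f : Fin r → MvPolynomial (Fin n) K0) (a : Fin r → ℕ) :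
    Fsa K0 n r f a ∈ Na K0 n r f a :=
  (Submodule.mem_sInf).2 fun _ hN => hN.1

theorem nabla_mem_Na (f : Fin r → MvPolynomial (Fin n) K0) (a : Fin r → ℕ) (i : Fin n)
    {g : Frac K0 n r} (hg : g ∈ Na K0 n r f a) : nabla K0 n r f i g ∈ Na K0 n r f a :=
  (Submodule.mem_sInf).2 fun N hN => hN.2 i g ((Submodule.mem_sInf).1 hg N hN)

theorem Na_le {f : Fin r → MvPolynomial (Fin n) K0} {a : Fin r → ℕ}
    {N : Submodule (XS K0 n r) (Frac K0 n r)} (h1 : Fsa K0 n r f a ∈ N)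
    (h2 : ∀ i, ∀ g ∈ N, nabla K0 n r f i g ∈ N) : Na K0 n r f a ≤ N :=
  sInf_le ⟨h1, h2⟩

theorem Fsa_add (f : Fin r → MvPolynomial (Fin n) K0) (a b : Fin r → ℕ) :
    Fsa K0 n r f (a + b) = Fsa K0 n r f a * Fsa K0 n r f b := by
  simp only [Fsa, ← toF_mul, ← Finset.prod_mul_distrib, Pi.add_apply, pow_add]

theorem Fsa_ne_zero {f : Fin r → MvPolynomial (Fin n) K0} (hf : ∀ j, f j ≠ 0) (a : Fin r → ℕ) :
    Fsa K0 n r f a ≠ 0 :=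
  toF_ne_zero (Finset.prod_ne_zero_iff.2 fun j _ => pow_ne_zero _ (px_ne_zero (hf j)))

theorem Na_add_le (f : Fin r → MvPolynomial (Fin n) K0) (a b : Fin r → ℕ) :
    Na K0 n r f (a + b) ≤ Na K0 n r f a := by
  refine Na_le ?_ fun i g hg => nabla_mem_Na f a i hg
  rw [Fsa_add, mul_comm, Fsa, ← smul_eq_toF_mul]
  exact Submodule.smul_mem _ _ (Fsa_mem_Na f a)

theorem DX_Fsa {f : Fin r → MvPolynomial (Fin n) K0} (hf : ∀ j, f j ≠ 0) (a : Fin r → ℕ)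
    (i : Fin n) : DX K0 n r i (Fsa K0 n r f a) = Fsa K0 n r f a *
      ∑ j, (a j : Frac K0 n r) * toF K0 n r (px K0 n r (pderiv i (f j))) /
        toF K0 n r (px K0 n r (f j)) := by
  have hpow : ∀ j, DX K0 n r i (toF K0 n r (px K0 n r (f j) ^ a j)) =
      toF K0 n r (px K0 n r (f j) ^ a j) *
        ((a j : Frac K0 n r) * toF K0 n r (px K0 n r (pderiv i (f j))) /
          toF K0 n r (px K0 n r (f j))) := by
    intro j
    have h0 := toF_ne_zero (px_ne_zero (r := r) (hf j))
    rw [toF_pow, ← derivX_apply, Derivation.leibniz_pow, derivX_apply, DX_px]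
    rcases Nat.eq_zero_or_pos (a j) with ha | ha
    · simp [ha]
    · obtain ⟨e, he⟩ := Nat.exists_eq_succ_of_ne_zero ha.ne'
      rw [he, Nat.succ_sub_one, Nat.succ_eq_add_one, pow_succ, smul_eq_mul, nsmul_eq_mul]
      field_simp
  have hs : ∀ s : Finset (Fin r), DX K0 n r i (toF K0 n r (∏ j ∈ s, px K0 n r (f j) ^ a j)) =
      toF K0 n r (∏ j ∈ s, px K0 n r (f j) ^ a j) *
      ∑ j ∈ s, (a j : Frac K0 n r) * toF K0 n r (px K0 n r (pderiv i (f j))) /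
        toF K0 n r (px K0 n r (f j)) := by
    intro s
    induction s using Finset.induction_on with
    | empty => simp [DX_toF, toF_zero]
    | insert j s hj ih =>
      rw [Finset.prod_insert hj, Finset.sum_insert hj, toF_mul, DX_mul, ih, hpow]
      ring
  exact hs Finset.univ

end BernsteinModule

section Shift

variable {K0 : Type} [Field K0] {n r : ℕ}

variable (n) in
/-- The substitution `s_j ↦ s_j - c_j`. -/
def shiftHom (c : Fin r → K0) : XS K0 n r →ₐ[K0] XS K0 n r :=
  aeval (Sum.elim (fun i => X (Sum.inl i)) fun j => X (Sum.inr j) - C (c j))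

theorem shiftHom_injective (c : Fin r → K0) : Function.Injective (shiftHom n c) := by
  have h : (shiftHom n (-c)).comp (shiftHom n c) = AlgHom.id K0 _ := by
    refine MvPolynomial.algHom_ext fun i => ?_
    rcases i with i | j
    · simp [shiftHom]
    · simp [shiftHom, algebraMap_eq]
  exact Function.LeftInverse.injective (g := shiftHom n (-c)) fun A => AlgHom.congr_fun h A

theorem pderiv_shiftHom (c : Fin r → K0) (i : Fin n) (A : XS K0 n r) :
    pderiv (Sum.inl i) (shiftHom n c A) = shiftHom n c (pderiv (Sum.inl i) A) := by
  classical
  induction A using MvPolynomial.induction_on with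
  | C a => simp [shiftHom, algebraMap_eq]
  | add p q hp hq => simp only [map_add, hp, hq]
  | mul_X p k hp =>
    rw [map_mul, pderiv_mul, pderiv_mul, hp, map_add, map_mul, map_mul]
    congr 2
    rcases k with k | k
    · simp only [shiftHom, aeval_X, Sum.elim_inl, pderiv_X, Pi.single_apply]
      split_ifs <;> simp
    · simp [shiftHom, pderiv_X]

theorem shiftHom_px (c : Fin r → K0) (p : MvPolynomial (Fin n) K0) :
    shiftHom n c (px K0 n r p) = px K0 n r p := by
  have h : (shiftHom n c).comp (rename Sum.inl) = rename Sum.inl :=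
    MvPolynomial.algHom_ext fun i => by simp [shiftHom]
  exact AlgHom.congr_fun h p

theorem exists_shiftHom_ps (c : Fin r → K0) (b : MvPolynomial (Fin r) K0) :
    ∃ b', shiftHom n c (ps K0 n r b) = ps K0 n r b' := by
  have h : (shiftHom n c).comp (rename Sum.inr) =
      (rename Sum.inr).comp (aeval fun j => X j - C (c j)) :=
    MvPolynomial.algHom_ext fun i => by simp [shiftHom]
  exact ⟨_, AlgHom.congr_fun h b⟩

variable (n) in
/-- The substitution `s_j ↦ s_j - c_j` on the fraction field. -/
def shiftFrac (c : Fin r → K0) : Frac K0 n r →+* Frac K0 n r :=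
  IsFractionRing.lift (A := XS K0 n r)
    (g := (algebraMap (XS K0 n r) (Frac K0 n r)).comp (shiftHom n c).toRingHom)
    (toF_injective.comp (shiftHom_injective c))

theorem shiftFrac_toF (c : Fin r → K0) (A : XS K0 n r) :
    shiftFrac n c (toF K0 n r A) = toF K0 n r (shiftHom n c A) :=
  IsFractionRing.lift_algebraMap _ _

theorem shiftFrac_toF_px (c : Fin r → K0) (p : MvPolynomial (Fin n) K0) :
    shiftFrac n c (toF K0 n r (px K0 n r p)) = toF K0 n r (px K0 n r p) := by
  rw [shiftFrac_toF, shiftHom_px]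

theorem DX_shiftFrac (c : Fin r → K0) (i : Fin n) (g : Frac K0 n r) :
    DX K0 n r i (shiftFrac n c g) = shiftFrac n c (DX K0 n r i g) := by
  obtain ⟨A, B, hB, rfl⟩ := exists_eq_toF_div g
  have hB' : shiftHom n c B ≠ 0 := fun h => hB (shiftHom_injective c (h.trans (map_zero _).symm))
  rw [map_div₀, shiftFrac_toF, shiftFrac_toF, DX_div _ _ _ hB, DX_div _ _ _ hB']
  simp only [pderiv_shiftHom, map_div₀, map_sub, map_mul, map_pow, shiftFrac_toF]

theorem shiftFrac_twist (f : Fin r → MvPolynomial (Fin n) K0) (b : Fin r → ℕ) (i : Fin n) :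
    shiftFrac n (fun j => (b j : K0)) (twist K0 n r f i) = twist K0 n r f i -
      ∑ j, (b j : Frac K0 n r) * toF K0 n r (px K0 n r (pderiv i (f j))) /
        toF K0 n r (px K0 n r (f j)) := by
  simp only [twist, map_sum, map_div₀, map_mul, shiftFrac_toF_px, ← Finset.sum_sub_distrib]
  refine Finset.sum_congr rfl fun j _ => ?_
  have h : shiftFrac n (fun j => (b j : K0)) (toF K0 n r (X (Sum.inr j))) =
      toF K0 n r (X (Sum.inr j)) - (b j : Frac K0 n r) := by
    rw [shiftFrac_toF]
    simp [shiftHom, toF_sub]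
    simp [toF]
  rw [h, sub_mul, sub_div]

theorem shiftFrac_div_mem_Na {f : Fin r → MvPolynomial (Fin n) K0} (hf : ∀ j, f j ≠ 0)
    (a b : Fin r → ℕ) {g : Frac K0 n r} (hg : g ∈ Na K0 n r f (b + a)) :
    shiftFrac n (fun j => (b j : K0)) g / Fsa K0 n r f b ∈ Na K0 n r f a := by
  let N : Submodule (XS K0 n r) (Frac K0 n r) :=
    { carrier := {g | shiftFrac n (fun j => (b j : K0)) g / Fsa K0 n r f b ∈ Na K0 n r f a}
      zero_mem' := by simp
      add_mem' := fun {g h} hg hh => by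
        rw [Set.mem_ofPred_eq, map_add, add_div]
        exact Submodule.add_mem _ hg hh
      smul_mem' := fun A g hg => by
        rw [Set.mem_ofPred_eq, smul_eq_toF_mul, map_mul, mul_div_assoc, shiftFrac_toF,
          ← smul_eq_toF_mul]
        exact Submodule.smul_mem _ _ hg }
  have h0 := Fsa_ne_zero hf b
  refine (Na_le (N := N) ?_ fun i g hg => ?_) hg
  · change shiftFrac n (fun j => (b j : K0)) (Fsa K0 n r f (b + a)) / Fsa K0 n r f b ∈ Na K0 n r f a
    have h1 : shiftFrac n (fun j => (b j : K0)) (Fsa K0 n r f (b + a)) =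
        Fsa K0 n r f (b + a) := by
      rw [Fsa, shiftFrac_toF, map_prod]
      simp only [map_pow, shiftHom_px]
    rw [h1, Fsa_add, mul_div_cancel_left₀ _ h0]
    exact Fsa_mem_Na f a
  · change shiftFrac n (fun j => (b j : K0)) (nabla K0 n r f i g) / Fsa K0 n r f b ∈ Na K0 n r f a
    have h2 := nabla_mem_Na f a i hg
    convert h2 using 1
    rw [nabla, nabla, map_add, map_mul, shiftFrac_twist, ← DX_shiftFrac, ← derivX_apply i (_ / _),
      Derivation.leibniz_div, derivX_apply, derivX_apply, DX_Fsa hf, smul_eq_mul, smul_eq_mul,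
      smul_eq_mul]
    field_simp
    ring

end Shift

section CoefficientField

variable {K0 : Type} [Field K0] {n r : ℕ}

variable (K0 n r) in
/-- The embedding of `K0[s_1,…,s_r]` into the fraction field of `K0[x,s]`. -/
def paramHom : MvPolynomial (Fin r) K0 →+* Frac K0 n r :=
  (algebraMap (XS K0 n r) (Frac K0 n r)).comp
    (rename Sum.inr : MvPolynomial (Fin r) K0 →ₐ[K0] XS K0 n r).toRingHom

theorem paramHom_injective : Function.Injective (paramHom K0 n r) :=
  toF_injective.comp (rename_injective _ Sum.inr_injective)

variable (K0 n r) in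
/-- The subfield `K0(s_1,…,s_r)` of the fraction field of `K0[x,s]`. -/
def paramField : Subfield (Frac K0 n r) :=
  (IsFractionRing.lift (K := FractionRing (MvPolynomial (Fin r) K0))
    (paramHom_injective (K0 := K0) (n := n) (r := r))).fieldRange

theorem toF_ps_mem_paramField (b : MvPolynomial (Fin r) K0) :
    toF K0 n r (ps K0 n r b) ∈ paramField K0 n r :=
  ⟨algebraMap _ _ b, IsFractionRing.lift_algebraMap _ _⟩

theorem exists_eq_div_of_mem_paramField {κ : Frac K0 n r} (h : κ ∈ paramField K0 n r) :
    ∃ a b : MvPolynomial (Fin r) K0, b ≠ 0 ∧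
      κ = toF K0 n r (ps K0 n r a) / toF K0 n r (ps K0 n r b) := by
  obtain ⟨y, rfl⟩ := h
  obtain ⟨a, b, hb, rfl⟩ := IsFractionRing.div_surjective (A := MvPolynomial (Fin r) K0) y
  refine ⟨a, b, nonZeroDivisors.ne_zero hb, ?_⟩
  rw [map_div₀, IsFractionRing.lift_algebraMap, IsFractionRing.lift_algebraMap]
  rfl

theorem DX_paramField (i : Fin n) (κ : paramField K0 n r) :
    DX K0 n r i (κ : Frac K0 n r) = 0 := by
  obtain ⟨a, b, hb, h⟩ := exists_eq_div_of_mem_paramField κ.2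
  rw [h, DX_div _ _ _ (ps_ne_zero hb), pderiv_ps, pderiv_ps, toF_zero]
  simp

/-- Multiplication by `x_i`, linear over the parameter field. -/
def mulXEnd (i : Fin n) : Module.End (paramField K0 n r) (Frac K0 n r) :=
  LinearMap.mulLeft (paramField K0 n r) (toF K0 n r (px K0 n r (X i)))

theorem mulXEnd_apply (i : Fin n) (g : Frac K0 n r) :
    mulXEnd i g = toF K0 n r (px K0 n r (X i)) * g := rfl

/-- The operator `∇_i`, linear over the parameter field. -/
def nablaEnd (f : Fin r → MvPolynomial (Fin n) K0) (i : Fin n) :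
    Module.End (paramField K0 n r) (Frac K0 n r) where
  toFun := nabla K0 n r f i
  map_add' := nabla_add f i
  map_smul' κ g := by
    rw [Subfield.smul_def, smul_eq_mul, nabla_mul, DX_paramField, zero_mul, zero_add,
      RingHom.id_apply, Subfield.smul_def, smul_eq_mul]

theorem nablaEnd_apply (f : Fin r → MvPolynomial (Fin n) K0) (i : Fin n) (g : Frac K0 n r) :
    nablaEnd f i g = nabla K0 n r f i g := rfl

theorem nablaEnd_commutator (f : Fin r → MvPolynomial (Fin n) K0) (i j : Fin n) :
    nablaEnd (r := r) f i * mulXEnd j - mulXEnd j * nablaEnd f i = if i = j then 1 else 0 := by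
  refine LinearMap.ext fun g => ?_
  rw [LinearMap.sub_apply, Module.End.mul_apply, Module.End.mul_apply, mulXEnd_apply,
    mulXEnd_apply, nablaEnd_apply, nablaEnd_apply, nabla_mul, add_sub_cancel_right, DX_px]
  split_ifs with h
  · subst h
    simp [px, toF]
  · rw [pderiv_X_of_ne (Ne.symm h)]
    simp [px, toF]

/-- The elements of the fraction field brought into `N` by a nonzero polynomial in `s`. -/
def paramSaturation (N : Submodule (XS K0 n r) (Frac K0 n r)) :
    Submodule (paramField K0 n r) (Frac K0 n r) where
  carrier := {g | ∃ b : MvPolynomial (Fin r) K0, b ≠ 0 ∧ toF K0 n r (ps K0 n r b) * g ∈ N}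
  zero_mem' := ⟨1, one_ne_zero, by simp⟩
  add_mem' := by
    rintro g h ⟨b, hb, hg⟩ ⟨b', hb', hh⟩
    refine ⟨b * b', mul_ne_zero hb hb', ?_⟩
    have : toF K0 n r (ps K0 n r (b * b')) * (g + h) =
        ps K0 n r b' • (toF K0 n r (ps K0 n r b) * g) +
          ps K0 n r b • (toF K0 n r (ps K0 n r b') * h) := by
      rw [smul_eq_toF_mul, smul_eq_toF_mul, ps, ps, ps, map_mul, toF_mul]; ring
    rw [this]
    exact N.add_mem (N.smul_mem _ hg) (N.smul_mem _ hh)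
  smul_mem' := by
    rintro κ g ⟨b, hb, hg⟩
    obtain ⟨a, b', hb', h⟩ := exists_eq_div_of_mem_paramField κ.2
    refine ⟨b * b', mul_ne_zero hb hb', ?_⟩
    have h0 := toF_ne_zero (ps_ne_zero (n := n) hb')
    have : toF K0 n r (ps K0 n r (b * b')) * (κ • g) =
        ps K0 n r a • (toF K0 n r (ps K0 n r b) * g) := by
      have hm : ps K0 n r (b * b') = ps K0 n r b * ps K0 n r b' := map_mul _ _ _
      rw [smul_eq_toF_mul, hm, toF_mul, Subfield.smul_def, smul_eq_mul, h]
      field_simp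
    rw [this]
    exact N.smul_mem _ hg

end CoefficientField

section PoleFiltration

variable {K0 : Type} [Field K0] {n r : ℕ}

theorem px_mul (p q : MvPolynomial (Fin n) K0) :
    px K0 n r (p * q) = px K0 n r p * px K0 n r q := map_mul _ _ _

theorem px_pow (p : MvPolynomial (Fin n) K0) (k : ℕ) :
    px K0 n r (p ^ k) = px K0 n r p ^ k := map_pow _ _ _

theorem px_sub (p q : MvPolynomial (Fin n) K0) :
    px K0 n r (p - q) = px K0 n r p - px K0 n r q := map_sub _ _ _

theorem px_prod {ι : Type*} (s : Finset ι) (p : ι → MvPolynomial (Fin n) K0) :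
    px K0 n r (∏ j ∈ s, p j) = ∏ j ∈ s, px K0 n r (p j) := map_prod _ _ _

variable (r) in
/-- The span over the parameter field of the fractions `q / F ^ v` with `q` a polynomial in `x`
of degree at most `v * D`. -/
def poleFiltration (F : MvPolynomial (Fin n) K0) (D v : ℕ) :
    Submodule (paramField K0 n r) (Frac K0 n r) :=
  Submodule.span _ {g | ∃ q : MvPolynomial (Fin n) K0, q.totalDegree ≤ v * D ∧
    g = toF K0 n r (px K0 n r q) / toF K0 n r (px K0 n r F) ^ v}

theorem div_mem_poleFiltration (F : MvPolynomial (Fin n) K0) {D v : ℕ}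
    {q : MvPolynomial (Fin n) K0} (hq : q.totalDegree ≤ v * D) :
    toF K0 n r (px K0 n r q) / toF K0 n r (px K0 n r F) ^ v ∈ poleFiltration r F D v :=
  Submodule.subset_span ⟨q, hq, rfl⟩

theorem poleFiltration_mono {F : MvPolynomial (Fin n) K0} (hF : F ≠ 0) {D : ℕ}
    (hFD : F.totalDegree ≤ D) : Monotone (poleFiltration r F D) := by
  refine monotone_nat_of_le_succ fun v => Submodule.span_le.2 ?_
  rintro _ ⟨q, hq, rfl⟩
  have h0 := toF_ne_zero (px_ne_zero (r := r) hF)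
  have h : toF K0 n r (px K0 n r q) / toF K0 n r (px K0 n r F) ^ v =
      toF K0 n r (px K0 n r (q * F)) / toF K0 n r (px K0 n r F) ^ (v + 1) := by
    rw [px_mul, toF_mul]
    field_simp
    ring
  rw [h]
  refine div_mem_poleFiltration F ((totalDegree_mul _ _).trans ?_)
  rw [add_mul, one_mul]
  exact add_le_add hq hFD

theorem mulXEnd_mem_poleFiltration {F : MvPolynomial (Fin n) K0} (hF : F ≠ 0) {D : ℕ}
    (hFD : F.totalDegree + 1 ≤ D) (i : Fin n) (v : ℕ) (g : Frac K0 n r)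
    (hg : g ∈ poleFiltration r F D v) : mulXEnd i g ∈ poleFiltration r F D (v + 1) := by
  suffices poleFiltration r F D v ≤ (poleFiltration r F D (v + 1)).comap (mulXEnd i) from this hg
  refine Submodule.span_le.2 ?_
  rintro _ ⟨q, hq, rfl⟩
  have h0 := toF_ne_zero (px_ne_zero (r := r) hF)
  have h : mulXEnd i (toF K0 n r (px K0 n r q) / toF K0 n r (px K0 n r F) ^ v) =
      toF K0 n r (px K0 n r (X i * q * F)) / toF K0 n r (px K0 n r F) ^ (v + 1) := by
    rw [px_mul, px_mul, toF_mul, toF_mul, mulXEnd_apply]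
    field_simp
    ring
  rw [SetLike.mem_coe, Submodule.mem_comap, h]
  refine div_mem_poleFiltration F ((totalDegree_mul _ _).trans ?_)
  have := totalDegree_mul (X i : MvPolynomial (Fin n) K0) q
  rw [totalDegree_X] at this
  rw [add_mul, one_mul]
  omega

theorem DX_div_pow {F : MvPolynomial (Fin n) K0} (hF : F ≠ 0) (i : Fin n) (v : ℕ)
    (q : MvPolynomial (Fin n) K0) :
    DX K0 n r i (toF K0 n r (px K0 n r q) / toF K0 n r (px K0 n r F) ^ v) =
      toF K0 n r (px K0 n r (pderiv i q * F - C (v : K0) * (q * pderiv i F))) /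
        toF K0 n r (px K0 n r F) ^ (v + 1) := by
  have h0 := toF_ne_zero (px_ne_zero (r := r) hF)
  have hv : toF K0 n r (px K0 n r (C (v : K0))) = (v : Frac K0 n r) := by
    simp [px, toF]
  have h1 := DX_mul i (toF K0 n r (px K0 n r q) / toF K0 n r (px K0 n r F) ^ v)
    (toF K0 n r (px K0 n r F) ^ v)
  have h2 : DX K0 n r i (toF K0 n r (px K0 n r F) ^ v) * toF K0 n r (px K0 n r F) =
      v * toF K0 n r (px K0 n r F) ^ v * toF K0 n r (px K0 n r (pderiv i F)) := by
    rw [← derivX_apply, Derivation.leibniz_pow, derivX_apply, DX_px]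
    rcases v with - | v
    · simp
    · rw [Nat.add_sub_cancel, smul_eq_mul, nsmul_eq_mul]
      ring
  rw [div_mul_cancel₀ _ (pow_ne_zero _ h0), DX_px] at h1
  rw [px_sub, px_mul, px_mul, px_mul, toF_sub, toF_mul, toF_mul, toF_mul, hv,
    eq_div_iff (pow_ne_zero _ h0)]
  have h3 : toF K0 n r (px K0 n r q) / toF K0 n r (px K0 n r F) ^ v * toF K0 n r (px K0 n r F) ^ v =
    toF K0 n r (px K0 n r q) := div_mul_cancel₀ _ (pow_ne_zero _ h0)
  linear_combination (-toF K0 n r (px K0 n r F)) * h1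
    - toF K0 n r (px K0 n r q) / toF K0 n r (px K0 n r F) ^ v * h2
    - v * toF K0 n r (px K0 n r (pderiv i F)) * h3

theorem twist_eq {f : Fin r → MvPolynomial (Fin n) K0} (hf : ∀ j, f j ≠ 0) (i : Fin n) :
    twist K0 n r f i = (∑ j, toF K0 n r (X (Sum.inr j)) *
      toF K0 n r (px K0 n r (pderiv i (f j) * ∏ k ∈ Finset.univ.erase j, f k))) /
        toF K0 n r (px K0 n r (∏ j, f j)) := by
  rw [twist, Finset.sum_div]
  refine Finset.sum_congr rfl fun j _ => ?_
  have h1 : ∏ k ∈ Finset.univ.erase j, f k ≠ 0 := Finset.prod_ne_zero_iff.2 fun k _ => hf k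
  have h2 := toF_ne_zero (px_ne_zero (r := r) h1)
  have h3 := toF_ne_zero (px_ne_zero (r := r) (hf j))
  rw [← Finset.mul_prod_erase _ _ (Finset.mem_univ j), px_mul, px_mul, toF_mul, toF_mul]
  field_simp

theorem nablaEnd_mem_poleFiltration {f : Fin r → MvPolynomial (Fin n) K0} (hf : ∀ j, f j ≠ 0)
    (i : Fin n) (v : ℕ) (g : Frac K0 n r)
    (hg : g ∈ poleFiltration r (∏ j, f j) (∑ j, (f j).totalDegree + 1) v) :
    nablaEnd f i g ∈ poleFiltration r (∏ j, f j) (∑ j, (f j).totalDegree + 1) (v + 1) := by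
  set D := ∑ j, (f j).totalDegree + 1 with hD
  set F := ∏ j, f j with hF
  suffices poleFiltration r F D v ≤ (poleFiltration r F D (v + 1)).comap (nablaEnd f i) from this hg
  have hF0 : F ≠ 0 := Finset.prod_ne_zero_iff.2 fun j _ => hf j
  have hFD : F.totalDegree + 1 ≤ D := Nat.succ_le_succ (totalDegree_finsetProd _ _)
  refine Submodule.span_le.2 ?_
  rintro _ ⟨q, hq, rfl⟩
  rw [SetLike.mem_coe, Submodule.mem_comap, nablaEnd_apply, nabla, DX_div_pow hF0, twist_eq hf]
  have hvD : (v + 1) * D = v * D + D := by ring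
  refine Submodule.add_mem _ (div_mem_poleFiltration F ?_) ?_
  · refine (totalDegree_sub _ _).trans (max_le ((totalDegree_mul _ _).trans ?_) ?_)
    · have := totalDegree_pderiv_le_sub_one q i
      omega
    · have h1 := totalDegree_mul (C (v : K0)) (q * pderiv i F)
      have h2 := totalDegree_mul q (pderiv i F)
      have h3 := totalDegree_pderiv_le_sub_one F i
      rw [totalDegree_C] at h1
      omega
  · have h : toF K0 n r (px K0 n r q) / toF K0 n r (px K0 n r F) ^ v *
        ((∑ j, toF K0 n r (X (Sum.inr j)) *
          toF K0 n r (px K0 n r (pderiv i (f j) * ∏ k ∈ Finset.univ.erase j, f k))) /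
          toF K0 n r (px K0 n r F)) =
        ∑ j, (⟨_, toF_ps_mem_paramField (X j)⟩ : paramField K0 n r) •
          (toF K0 n r (px K0 n r (q * (pderiv i (f j) * ∏ k ∈ Finset.univ.erase j, f k))) /
            toF K0 n r (px K0 n r F) ^ (v + 1)) := by
      rw [div_mul_div_comm, ← pow_succ, Finset.mul_sum, Finset.sum_div]
      refine Finset.sum_congr rfl fun j _ => ?_
      rw [Subfield.smul_def, smul_eq_mul, px_mul q, toF_mul, toF_X_inr_eq]
      ring
    rw [h]
    refine Submodule.sum_mem _ fun j _ => Submodule.smul_mem _ _ (div_mem_poleFiltration F ?_)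
    have h1 := totalDegree_mul q (pderiv i (f j) * ∏ k ∈ Finset.univ.erase j, f k)
    have h2 := totalDegree_mul (pderiv i (f j)) (∏ k ∈ Finset.univ.erase j, f k)
    have h3 := totalDegree_pderiv_le_sub_one (f j) i
    have h4 : (∏ k ∈ Finset.univ.erase j, f k).totalDegree ≤
        ∑ k ∈ Finset.univ.erase j, (f k).totalDegree := totalDegree_finsetProd _ _
    have h5 := Finset.add_sum_erase Finset.univ (fun j => (f j).totalDegree) (Finset.mem_univ j)
    omega

theorem poleFiltration_le_span (F : MvPolynomial (Fin n) K0) (D v : ℕ) :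
    poleFiltration r F D v ≤ Submodule.span (paramField K0 n r)
      (Set.range fun e : Fin n → Fin (v * D + 1) =>
        toF K0 n r (px K0 n r (monomial (Finsupp.equivFunOnFinite.symm fun i => (e i : ℕ)) 1)) /
          toF K0 n r (px K0 n r F) ^ v) := by
  refine Submodule.span_le.2 ?_
  rintro _ ⟨q, hq, rfl⟩
  have h : toF K0 n r (px K0 n r q) / toF K0 n r (px K0 n r F) ^ v =
      ∑ m ∈ q.support, (⟨_, toF_ps_mem_paramField (C (coeff m q))⟩ : paramField K0 n r) •
        (toF K0 n r (px K0 n r (monomial m 1)) / toF K0 n r (px K0 n r F) ^ v) := by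
    conv_lhs => rw [q.as_sum]
    rw [px, map_sum, toF, map_sum, Finset.sum_div]
    refine Finset.sum_congr rfl fun m _ => ?_
    rw [Subfield.smul_def, smul_eq_mul, ← mul_div_assoc, ← toF_mul, ← mul_one (coeff m q),
      ← C_mul_monomial, map_mul, rename_C, mul_one, ps, rename_C]
    rfl
  rw [SetLike.mem_coe, h]
  refine Submodule.sum_mem _ fun m hm => Submodule.smul_mem _ _ (Submodule.subset_span ?_)
  refine ⟨fun i => ⟨m i, Nat.lt_succ_of_le ((Finsupp.le_degree i m).trans
    ((le_totalDegree hm).trans hq))⟩, ?_⟩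
  simp

set_option synthInstance.maxHeartbeats 200000 in
theorem finiteDimensional_poleFiltration (F : MvPolynomial (Fin n) K0) (D v : ℕ) :
    FiniteDimensional (paramField K0 n r) (poleFiltration r F D v) :=
  have := FiniteDimensional.span_of_finite (paramField K0 n r) (Set.finite_range
    fun e : Fin n → Fin (v * D + 1) =>
      toF K0 n r (px K0 n r (monomial (Finsupp.equivFunOnFinite.symm fun i => (e i : ℕ)) 1)) /
        toF K0 n r (px K0 n r F) ^ v)
  Submodule.finiteDimensional_of_le (poleFiltration_le_span F D v)

set_option synthInstance.maxHeartbeats 200000 in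
theorem finrank_poleFiltration_le (F : MvPolynomial (Fin n) K0) (D v : ℕ) :
    Module.finrank (paramField K0 n r) (poleFiltration r F D v) ≤ (v * D + 1) ^ n := by
  have := FiniteDimensional.span_of_finite (paramField K0 n r) (Set.finite_range
    fun e : Fin n → Fin (v * D + 1) =>
      toF K0 n r (px K0 n r (monomial (Finsupp.equivFunOnFinite.symm fun i => (e i : ℕ)) 1)) /
        toF K0 n r (px K0 n r F) ^ v)
  refine (Submodule.finrank_mono (poleFiltration_le_span F D v)).trans
    ((finrank_range_le_card _).trans ?_)
  simp

theorem exists_mem_poleFiltration {F : MvPolynomial (Fin n) K0} (hF : F ≠ 0) {D : ℕ}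
    (hFD : F.totalDegree + 1 ≤ D) (P : MvPolynomial (Fin n) K0) :
    ∃ v, toF K0 n r (px K0 n r P) ∈ poleFiltration r F D v := by
  refine ⟨P.totalDegree, ?_⟩
  have h0 := toF_ne_zero (px_ne_zero (r := r) hF)
  have h : toF K0 n r (px K0 n r P) = toF K0 n r (px K0 n r (P * F ^ P.totalDegree)) /
      toF K0 n r (px K0 n r F) ^ P.totalDegree := by
    rw [px_mul, px_pow, toF_mul, toF_pow]
    field_simp
  rw [h]
  refine div_mem_poleFiltration F ((totalDegree_mul _ _).trans
    ((Nat.add_le_add_left (totalDegree_pow _ _) _).trans ?_))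
  calc P.totalDegree + P.totalDegree * F.totalDegree
      = P.totalDegree * (F.totalDegree + 1) := by ring
    _ ≤ _ := Nat.mul_le_mul_left _ hFD

end PoleFiltration

section BernsteinSato

variable {K0 : Type} [Field K0] {n r : ℕ}

set_option synthInstance.maxHeartbeats 200000 in
theorem exists_param_mul_mem_succ [CharZero K0] {f : Fin r → MvPolynomial (Fin n) K0}
    (hf : ∀ j, f j ≠ 0) (a : Fin r → ℕ) :
    ∃ (k : ℕ) (b : MvPolynomial (Fin r) K0), b ≠ 0 ∧
      toF K0 n r (ps K0 n r b) * Fsa K0 n r f (k • a) ∈ Na K0 n r f (k • a + a) := by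
  have hF0 : ∏ j, f j ≠ 0 := Finset.prod_ne_zero_iff.2 fun j _ => hf j
  have hFD := Nat.succ_le_succ (totalDegree_finsetProd Finset.univ f)
  have : CharZero (Frac K0 n r) := charZero_of_injective_algebraMap
    (R := K0) (algebraMap K0 (Frac K0 n r)).injective
  have : CharZero (paramField K0 n r) :=
    (algebraMap (paramField K0 n r) (Frac K0 n r)).charZero_iff
      (algebraMap (paramField K0 n r) (Frac K0 n r)).injective |>.2 inferInstance
  obtain ⟨k, hk⟩ := exists_mem_succ_of_weyl_chain (K := paramField K0 n r) (V := Frac K0 n r)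
    (mulXEnd (K0 := K0) (n := n) (r := r)) (nablaEnd f)
    (fun i j => LinearMap.ext fun g => by
      simp only [Module.End.mul_apply, mulXEnd_apply]; ring)
    (fun i j => LinearMap.ext fun g => by
      simp only [Module.End.mul_apply, nablaEnd_apply]; exact nabla_comm f i j g)
    (nablaEnd_commutator f) (poleFiltration r (∏ j, f j) (∑ j, (f j).totalDegree + 1))
    (poleFiltration_mono hF0 (Nat.le_of_succ_le hFD))
    (finiteDimensional_poleFiltration _ _) (mulXEnd_mem_poleFiltration hF0 hFD)
    (nablaEnd_mem_poleFiltration hf) _ (finrank_poleFiltration_le _ _)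
    (fun k => paramSaturation (Na K0 n r f (k • a)))
    (antitone_nat_of_succ_le fun k g => by
      rintro ⟨b, hb, hg⟩
      rw [succ_nsmul] at hg
      exact ⟨b, hb, Na_add_le f _ _ hg⟩)
    (fun k i g => by
      rintro ⟨b, hb, hg⟩
      refine ⟨b, hb, ?_⟩
      rw [mulXEnd_apply, mul_left_comm, ← smul_eq_toF_mul]
      exact Submodule.smul_mem _ _ hg)
    (fun k i g => by
      rintro ⟨b, hb, hg⟩
      refine ⟨b, hb, ?_⟩
      have h := nabla_mem_Na f _ i hg
      rwa [nabla_mul, DX_toF, pderiv_ps, toF_zero, zero_mul, zero_add] at h)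
    (fun k => Fsa K0 n r f (k • a))
    (fun k => ⟨1, one_ne_zero, by
      rw [ps, map_one, toF_one, one_mul]; exact Fsa_mem_Na f _⟩)
    (fun k => by
      have h : Fsa K0 n r f (k • a) = toF K0 n r (px K0 n r (∏ j, f j ^ (k • a) j)) := by
        simp only [Fsa, px_prod, px_pow]
      rw [h]
      exact exists_mem_poleFiltration hF0 hFD _)
  obtain ⟨b, hb, h⟩ := hk
  rw [succ_nsmul] at h
  exact ⟨k, b, hb, h⟩

/-- Bernstein–Sato ideals are nonzero. -/
theorem exists_mem_BS_ne_zero [CharZero K0] {f : Fin r → MvPolynomial (Fin n) K0}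
    (hf : ∀ j, f j ≠ 0) (a : Fin r → ℕ) : ∃ b ∈ BS K0 n r f a, b ≠ 0 := by
  obtain ⟨k, b, hb, h⟩ := exists_param_mul_mem_succ hf a
  have h1 := shiftFrac_div_mem_Na hf a (k • a) h
  obtain ⟨b', hb'⟩ := exists_shiftHom_ps (n := n) (fun j => ((k • a) j : K0)) b
  have h2 : shiftFrac n (fun j => ((k • a) j : K0)) (Fsa K0 n r f (k • a)) =
      Fsa K0 n r f (k • a) := by
    rw [Fsa, shiftFrac_toF, map_prod]
    simp only [map_pow, shiftHom_px]
  rw [map_mul, h2, mul_div_cancel_right₀ _ (Fsa_ne_zero hf _), shiftFrac_toF, hb'] at h1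
  refine ⟨b', h1, ?_⟩
  rintro rfl
  exact ps_ne_zero hb (shiftHom_injective _ (hb'.trans (by rw [ps, map_zero, map_zero])))

end BernsteinSato

section Specialization

variable {K0 : Type} [Field K0] {n r : ℕ}

variable (n) in
/-- The specialization `s = α`. -/
def specialize (α : Fin r → K0) : XS K0 n r →ₐ[K0] MvPolynomial (Fin n) K0 :=
  aeval (Sum.elim X fun j => C (α j))

theorem specialize_px (α : Fin r → K0) (q : MvPolynomial (Fin n) K0) :
    specialize n α (px K0 n r q) = q := by
  rw [specialize, px, aeval_rename, Sum.elim_comp_inl, aeval_X_left_apply]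

theorem specialize_ps (α : Fin r → K0) (b : MvPolynomial (Fin r) K0) :
    specialize n α (ps K0 n r b) = C (eval α b) := by
  have h : (specialize n α).comp (rename Sum.inr) =
      (Algebra.ofId K0 (MvPolynomial (Fin n) K0)).comp (aeval α) :=
    MvPolynomial.algHom_ext fun j => by simp [specialize, Algebra.ofId_apply, algebraMap_eq]
  exact (AlgHom.congr_fun h b).trans (by simp [Algebra.ofId_apply, algebraMap_eq])

theorem pderiv_specialize (α : Fin r → K0) (i : Fin n) (A : XS K0 n r) :
    pderiv i (specialize n α A) = specialize n α (pderiv (Sum.inl i) A) := by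
  classical
  induction A using MvPolynomial.induction_on with
  | C a => simp [specialize, algebraMap_eq]
  | add p q hp hq => simp only [map_add, hp, hq]
  | mul_X p k hp =>
    rw [map_mul, pderiv_mul, pderiv_mul, hp, map_add, map_mul, map_mul]
    congr 2
    rcases k with k | k
    · simp only [specialize, aeval_X, Sum.elim_inl, pderiv_X, Pi.single_apply, Sum.inl.injEq]
      split_ifs <;> simp
    · simp [specialize, pderiv_X]

theorem pderiv_pow_mul_self {σ : Type*} (i : σ) (p : MvPolynomial σ K0) (k : ℕ) :
    pderiv i (p ^ k) * p = k * p ^ k * pderiv i p := by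
  rw [pderiv_pow]
  rcases k with - | k
  · simp
  · rw [Nat.add_sub_cancel]
    ring

theorem twist_mul_mul (N : Fin r → ℕ) {p : MvPolynomial (Fin n) K0} (hp : p ≠ 0)
    {f u : Fin r → MvPolynomial (Fin n) K0} (hu : ∀ j, u j ≠ 0) (hfu : ∀ j, f j = p ^ N j * u j)
    (i : Fin n) :
    twist K0 n r f i * toF K0 n r (px K0 n r (p * ∏ j, u j)) =
      toF K0 n r (∑ j, X (Sum.inr j) * px K0 n r (N j * pderiv i p * ∏ j, u j +
        p * (pderiv i (u j) * ∏ k ∈ Finset.univ.erase j, u k))) := by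
  rw [twist, Finset.sum_mul]
  refine (Finset.sum_congr rfl fun j _ => ?_).trans
    (map_sum (algebraMap (XS K0 n r) (Frac K0 n r)) _ _).symm
  have hf : f j ≠ 0 := by rw [hfu]; exact mul_ne_zero (pow_ne_zero _ hp) (hu j)
  have h0 := toF_ne_zero (px_ne_zero (r := r) hf)
  have h1 : pderiv i (f j) * (p * ∏ j, u j) = f j * (N j * pderiv i p * ∏ j, u j +
      p * (pderiv i (u j) * ∏ k ∈ Finset.univ.erase j, u k)) := by
    have h2 := pderiv_pow_mul_self i p (N j)
    have h3 := Finset.mul_prod_erase Finset.univ u (Finset.mem_univ j)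
    rw [hfu, pderiv_mul]
    linear_combination (u j * ∏ j, u j) * h2 - (p ^ N j * pderiv i (u j) * p) * h3
  have h4 := congrArg (fun q => toF K0 n r (px K0 n r q)) h1
  simp only [px_mul (pderiv i (f j)), px_mul (f j), toF_mul] at h4
  change _ = toF K0 n r _
  rw [toF_mul, div_mul_eq_mul_div, div_eq_iff h0]
  linear_combination toF K0 n r (X (Sum.inr j)) * h4

/-- The fractions which, after the specialization `s = α`, vanish to order at least `c` along
`p = 0`, in the sense that they have a suitable representative. -/
def vanishingSubmodule {p : MvPolynomial (Fin n) K0} (hp : Prime p) (α : Fin r → K0) (c : ℕ) :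
    Submodule (XS K0 n r) (Frac K0 n r) where
  carrier := {g | ∃ (k : ℕ) (d : MvPolynomial (Fin n) K0) (A : XS K0 n r), ¬ p ∣ d ∧
    g * toF K0 n r (px K0 n r (p ^ k * d)) = toF K0 n r A ∧ p ^ (c + k) ∣ specialize n α A}
  zero_mem' := ⟨0, 1, 0, hp.not_dvd_one, by rw [zero_mul, toF_zero], by rw [map_zero]; simp⟩
  add_mem' := by
    rintro g h ⟨k, d, A, hd, hA, hdA⟩ ⟨l, e, B, he, hB, hdB⟩
    refine ⟨k + l, d * e, A * px K0 n r (p ^ l * e) + B * px K0 n r (p ^ k * d),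
      fun h => (hp.dvd_or_dvd h).elim hd he, ?_, ?_⟩
    · rw [toF_add, toF_mul, toF_mul, ← hA, ← hB]
      simp only [px_mul, px_pow, toF_mul, toF_pow]
      ring
    · rw [map_add, map_mul, map_mul, specialize_px, specialize_px]
      refine dvd_add ?_ ?_
      · refine Dvd.dvd.trans (dvd_of_eq ?_) (mul_dvd_mul hdA (dvd_mul_right (p ^ l) e))
        ring
      · refine Dvd.dvd.trans (dvd_of_eq ?_) (mul_dvd_mul hdB (dvd_mul_right (p ^ k) d))
        ring
  smul_mem' := by
    rintro B g ⟨k, d, A, hd, hA, hdA⟩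
    refine ⟨k, d, B * A, hd, ?_, ?_⟩
    · rw [smul_eq_toF_mul, toF_mul, mul_assoc, hA]
    · rw [map_mul]
      exact hdA.mul_left _

theorem nabla_mem_vanishingSubmodule (N : Fin r → ℕ) {p : MvPolynomial (Fin n) K0} (hp : Prime p)
    {f u : Fin r → MvPolynomial (Fin n) K0} (hu : ∀ j, ¬ p ∣ u j)
    (hfu : ∀ j, f j = p ^ N j * u j) {α : Fin r → K0} {c : ℕ}
    (hα : (∑ j, (N j : K0) * α j) + (c : K0) = 0) (i : Fin n) {g : Frac K0 n r}
    (hg : g ∈ vanishingSubmodule hp α c) : nabla K0 n r f i g ∈ vanishingSubmodule hp α c := by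
  obtain ⟨k, d, A, hd, hA, H, hH⟩ := hg
  set U := ∏ j, u j with hU
  have hpU : ¬ p ∣ U := fun h => by
    obtain ⟨j, -, hj⟩ := (hp.dvd_finsetProd_iff u).1 h
    exact hu j hj
  set T : XS K0 n r := ∑ j, X (Sum.inr j) * px K0 n r (N j * pderiv i p * U +
        p * (pderiv i (u j) * ∏ k ∈ Finset.univ.erase j, u k)) with hT
  have htw : twist K0 n r f i * toF K0 n r (px K0 n r (p * U)) = toF K0 n r T :=
    twist_mul_mul N hp.ne_zero (fun j h => hu j (by rw [h]; exact dvd_zero p)) hfu i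
  have hsT : specialize n α T = -(c : MvPolynomial (Fin n) K0) * (pderiv i p * U) +
      p * ∑ j, C (α j) * (pderiv i (u j) * ∏ k ∈ Finset.univ.erase j, u k) := by
    have h := congrArg (C : K0 →+* MvPolynomial (Fin n) K0) hα
    simp only [map_add, map_sum, map_mul, map_natCast, map_zero] at h
    have h' : specialize n α T = (∑ j, N j * C (α j)) * (pderiv i p * U) +
        p * ∑ j, C (α j) * (pderiv i (u j) * ∏ k ∈ Finset.univ.erase j, u k) := by
      rw [hT, map_sum, Finset.sum_mul, Finset.mul_sum, ← Finset.sum_add_distrib]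
      refine Finset.sum_congr rfl fun j _ => ?_
      rw [map_mul, specialize_px, specialize, aeval_X, Sum.elim_inr]
      ring
    rw [h']
    linear_combination (pderiv i p * U) * h
  refine ⟨k + 1, d * (d * U), pderiv (Sum.inl i) A * px K0 n r (p * d * U) -
    A * px K0 n r (k * pderiv i p * d * U + p * pderiv i d * U) + A * px K0 n r d * T,
    fun h => (hp.dvd_or_dvd h).elim hd fun h => (hp.dvd_or_dvd h).elim hd hpU, ?_, ?_⟩
  · have h1 := congrArg (DX K0 n r i) hA
    rw [DX_mul, DX_px, DX_toF] at h1
    have h2 : pderiv i (p ^ k * d) * p =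
        p ^ k * (k * pderiv i p * d + p * pderiv i d) := by
      rw [pderiv_mul]
      linear_combination d * pderiv_pow_mul_self i p k
    have h3 := congrArg (fun q => toF K0 n r (px K0 n r q)) h2
    simp only [px_mul _ p, px_mul (p ^ k), toF_mul] at h3
    rw [px_mul, toF_mul] at htw hA h1
    have h6 : px K0 n r (p ^ (k + 1) * (d * (d * U))) = px K0 n r (p ^ k) * px K0 n r p *
        (px K0 n r d * (px K0 n r d * px K0 n r U)) := by
      rw [px_mul, px_mul, px_mul, pow_succ, px_mul]
    rw [h6, ← add_mul]
    simp only [toF_add, toF_sub, px_mul (_ + _), px_mul p, px_mul (p * d), toF_mul, ← htw, ← h1,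
      nabla, ← hA]
    linear_combination (-g * toF K0 n r (px K0 n r d) * toF K0 n r (px K0 n r U)) * h3
  · have h4 := congrArg (pderiv i) hH
    rw [pderiv_specialize, pderiv_mul] at h4
    have h5 := pderiv_pow_mul_self i p (c + k)
    rw [map_add, map_sub, map_mul, map_mul, map_mul, map_mul, specialize_px, specialize_px,
      specialize_px, hsT, hH, h4]
    refine ⟨pderiv i H * d * U - H * pderiv i d * U +
      H * d * ∑ j, C (α j) * (pderiv i (u j) * ∏ k ∈ Finset.univ.erase j, u k), ?_⟩
    push_cast at h5
    linear_combination (H * d * U) * h5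

theorem hyperplane_subset_ZBS {f : Fin r → MvPolynomial (Fin n) ℂ} (a : Fin r → ℕ)
    {p : MvPolynomial (Fin n) ℂ} (hp : Irreducible p) {N : Fin r → ℕ}
    (hN : ∀ j, p ^ N j ∣ f j ∧ ¬ p ^ (N j + 1) ∣ f j) {c : ℕ}
    (hc0 : c ≠ 0) (hc : c ≤ ∑ j, N j * a j) :
    {α : Fin r → ℂ | (∑ j, (N j : ℂ) * α j) + (c : ℂ) = 0} ⊆ ZBS n r f a := by
  intro α hα b hb
  choose u hfu using fun j => (hN j).1
  have hu : ∀ j, ¬ p ∣ u j := fun j h => (hN j).2 (by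
    rw [hfu j, pow_succ]
    exact mul_dvd_mul_left _ h)
  have hle : Na ℂ n r f a ≤ vanishingSubmodule hp.prime α c := by
    refine Na_le ⟨0, 1, ∏ j, px ℂ n r (f j) ^ a j, hp.prime.not_dvd_one, ?_, ?_⟩
      fun i g hg => nabla_mem_vanishingSubmodule N hp.prime hu hfu hα i hg
    · rw [pow_zero, one_mul, px, map_one, toF_one, mul_one, Fsa]
    · rw [map_prod]
      simp only [map_pow, specialize_px]
      refine (pow_dvd_pow p hc).trans ?_
      rw [← Finset.prod_pow_eq_pow_sum]
      refine Finset.prod_dvd_prod_of_dvd _ _ fun j _ => ?_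
      rw [pow_mul]
      exact pow_dvd_pow_of_dvd (hN j).1 _
  obtain ⟨k, d, A, hd, hA, hdA⟩ := hle hb
  rw [← toF_mul] at hA
  rw [← toF_injective hA, map_mul, specialize_ps, specialize_px, add_comm,
    pow_add, mul_left_comm] at hdA
  by_contra hb0
  have h1 := (dvd_pow_self p hc0).trans
    ((mul_dvd_mul_iff_left (pow_ne_zero k hp.ne_zero)).1 hdA)
  have h2 : IsUnit (C (eval α b) : MvPolynomial (Fin n) ℂ) := (IsUnit.mk0 _ hb0).map C
  exact hd (h2.dvd_mul_left.1 h1)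

end Specialization

section Hyperplane

variable {k : Type*} [Field k] [Infinite k] {r : ℕ}

theorem dvd_of_eval_eq_zero_on_hyperplane (N : Fin r → k) (c : k) {j₀ : Fin r} (hj : N j₀ ≠ 0)
    {q : MvPolynomial (Fin r) k} (hq : ∀ α : Fin r → k, (∑ j, N j * α j) + c = 0 → eval α q = 0) :
    (∑ j, C (N j) * X j) + C c ∣ q := by
  classical
  set ℓ : MvPolynomial (Fin r) k := (∑ j, C (N j) * X j) + C c with hℓ
  let t : Fin r → MvPolynomial (Fin r) k :=
    Function.update X j₀ (X j₀ - C (N j₀)⁻¹ * ℓ)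
  have hsub : ∀ q : MvPolynomial (Fin r) k, ℓ ∣ q - aeval t q := by
    intro q
    induction q using MvPolynomial.induction_on with
    | C a => simp [algebraMap_eq]
    | add p q hp hq =>
      rw [map_add, add_sub_add_comm]
      exact dvd_add hp hq
    | mul_X p i hp =>
      have hi : ℓ ∣ X i - t i := by
        by_cases h : i = j₀
        · subst h
          simp [t]
        · simp [t, h]
      rw [map_mul, aeval_X]
      have : p * X i - aeval t p * t i = (p - aeval t p) * X i + aeval t p * (X i - t i) := by ring
      rw [this]
      exact dvd_add (hp.mul_right _) (hi.mul_left _)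
  have hzero : aeval t q = 0 := by
    refine MvPolynomial.funext fun α => ?_
    rw [map_zero]
    have h1 : eval α (aeval t q) = eval (fun j => eval α (t j)) q := by
      rw [← coe_aeval_eq_eval, ← coe_aeval_eq_eval]
      exact comp_aeval_apply t (aeval α) q
    rw [h1]
    refine hq _ ?_
    have h2 : ∀ j, N j * eval α (t j) = N j * α j - if j = j₀ then eval α ℓ else 0 := by
      intro j
      split_ifs with h
      · subst h
        simp only [t, Function.update_self, map_sub, map_mul, eval_X, eval_C]
        field_simp
      · simp [t, h]
    simp only [h2, Finset.sum_sub_distrib, Finset.sum_ite_eq', Finset.mem_univ, if_true]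
    simp [hℓ]
  have h := hsub q
  rwa [hzero, sub_zero] at h

theorem exists_pow_mul_of_hyperplane (N : Fin r → k) (c : k) {j₀ : Fin r} (hj : N j₀ ≠ 0)
    {b : MvPolynomial (Fin r) k} (hb : b ≠ 0) :
    ∃ (e : ℕ) (b' : MvPolynomial (Fin r) k), b = ((∑ j, C (N j) * X j) + C c) ^ e * b' ∧
      ¬ (∀ α : Fin r → k, (∑ j, N j * α j) + c = 0 → eval α b' = 0) := by
  classical
  have hunit : ¬ IsUnit ((∑ j, C (N j) * X j) + C c : MvPolynomial (Fin r) k) := by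
    intro h
    have := h.map (eval (Pi.single j₀ (-c / N j₀)))
    simp [Pi.single_apply, mul_div_cancel₀, hj] at this
  obtain ⟨b', h1, h2⟩ :=
    (FiniteMultiplicity.of_not_isUnit hunit hb).exists_eq_pow_mul_and_not_dvd
  exact ⟨_, b', h1, fun h => h2 (dvd_of_eval_eq_zero_on_hyperplane N c hj h)⟩

end Hyperplane

theorem zarClosed_zeroLocus {r : ℕ} (q : MvPolynomial (Fin r) ℂ) :
    zarClosed r {α | eval α q = 0} :=
  ⟨{q}, by simp⟩

theorem irredSet_eq_hyperplane {r : ℕ} (N : Fin r → ℂ) (c : ℂ) {j₀ : Fin r} (hj : N j₀ ≠ 0)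
    {b : MvPolynomial (Fin r) ℂ} (hb : b ≠ 0) {W : Set (Fin r → ℂ)} (hW : irredSet r W)
    (hWb : ∀ α ∈ W, eval α b = 0) (hHW : {α : Fin r → ℂ | (∑ j, N j * α j) + c = 0} ⊆ W) :
    W = {α : Fin r → ℂ | (∑ j, N j * α j) + c = 0} := by
  obtain ⟨e, b', rfl, h⟩ := exists_pow_mul_of_hyperplane N c hj hb
  rcases hW.2 _ _ (zarClosed_zeroLocus ((∑ j, C (N j) * X j) + C c)) (zarClosed_zeroLocus b')
    fun α hα => by
      have := hWb α hα
      rw [map_mul, map_pow] at this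
      exact (mul_eq_zero.1 this).imp eq_zero_of_pow_eq_zero id with h1 | h1
  · refine Set.Subset.antisymm (fun α hα => ?_) hHW
    have := h1 hα
    simpa using this
  · exact absurd (fun α hα => h1 (hHW hα)) h

/-- If `p` is an irreducible factor of `f = f_1⋯f_r`, `N_j` is the multiplicity of `p` in `f_j`
and `m = ∑ N_j a_j ≠ 0`, then for `1 ≤ c ≤ m` the hyperplane `N₁s₁ + ⋯ + N_r s_r + c = 0` is an
irreducible component of `Z(B_F^a)`: it is contained in `Z(B_F^a)` and is maximal among
irreducible Zariski closed subsets of `ℂ^r` contained in `Z(B_F^a)`. -/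
theorem stmt1 (n r : ℕ) (hn : 1 ≤ n) (hr : 1 ≤ r)
    (f : Fin r → MvPolynomial (Fin n) ℂ) (hf : ∀ j, f j ≠ 0)
    (a : Fin r → ℕ) (hfa : ∀ c : ℂ, (∏ j, f j ^ a j) ≠ C c)
    (p : MvPolynomial (Fin n) ℂ) (hp : Irreducible p) (hpf : p ∣ ∏ j, f j)
    (N : Fin r → ℕ) (hN : ∀ j, p ^ N j ∣ f j ∧ ¬ p ^ (N j + 1) ∣ f j)
    (m : ℕ) (hm : m = ∑ j, N j * a j) (hm0 : m ≠ 0)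
    (c : ℕ) (hc1 : 1 ≤ c) (hcm : c ≤ m) :
    ({α : Fin r → ℂ | (∑ j, (N j : ℂ) * α j) + (c : ℂ) = 0} ⊆ ZBS n r f a) ∧
    (∀ W : Set (Fin r → ℂ), zarClosed r W → irredSet r W → W ⊆ ZBS n r f a →
      {α : Fin r → ℂ | (∑ j, (N j : ℂ) * α j) + (c : ℂ) = 0} ⊆ W →
      W = {α : Fin r → ℂ | (∑ j, (N j : ℂ) * α j) + (c : ℂ) = 0}) := by
  obtain ⟨b, hb, hb0⟩ := exists_mem_BS_ne_zero hf a
  obtain ⟨j₀, -, hj₀⟩ := Finset.exists_ne_zero_of_sum_ne_zero (hm ▸ hm0)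
  have hNj : (N j₀ : ℂ) ≠ 0 := Nat.cast_ne_zero.2 (left_ne_zero_of_mul hj₀)
  exact ⟨hyperplane_subset_ZBS a hp hN (Nat.one_le_iff_ne_zero.1 hc1) (hm ▸ hcm),
    fun W _ hW hWZ hHW => irredSet_eq_hyperplane _ _ hNj hb0 hW (fun α hα => hWZ hα b hb) hHW⟩

end
end

section
/- Suppose n = 1 and f_j = x^{N_j} for natural numbers N_1,…,N_r, with m := N_1·a_1 + ⋯ + N_r·a_r > 0. Then the Bernstein–Sato ideal B_F^a is the principal ideal of ℂ[s_1,…,s_r] generated by the polynomial ∏_{c=1}^{m} (N_1·s_1 + ⋯ + N_r·s_r + c). -/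
open MvPolynomial MeasureTheory

noncomputable section

namespace BernsteinSato

section Derivation

variable {K0 : Type} [Field K0] {n r : ℕ}

lemma toF_ne_zero {p : XS K0 n r} (hp : p ≠ 0) : toF K0 n r p ≠ 0 :=
  (map_ne_zero_iff (algebraMap (XS K0 n r) (Frac K0 n r))
    (IsFractionRing.injective (XS K0 n r) (Frac K0 n r))).2 hp

lemma toF_injective : Function.Injective (toF K0 n r) :=
  IsFractionRing.injective (XS K0 n r) (Frac K0 n r)

lemma toF_add (p q : XS K0 n r) : toF K0 n r (p + q) = toF K0 n r p + toF K0 n r q :=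
  map_add _ p q

lemma toF_mul (p q : XS K0 n r) : toF K0 n r (p * q) = toF K0 n r p * toF K0 n r q :=
  map_mul _ p q

lemma toF_pow (p : XS K0 n r) (k : ℕ) : toF K0 n r (p ^ k) = toF K0 n r p ^ k :=
  map_pow _ p k

lemma toF_zero : toF K0 n r 0 = 0 := map_zero _

lemma toF_one : toF K0 n r 1 = 1 := map_one _

lemma exists_eq_div (g : Frac K0 n r) :
    ∃ p q : XS K0 n r, q ≠ 0 ∧ g = toF K0 n r p / toF K0 n r q := by
  obtain ⟨p, q, hq, h⟩ := IsFractionRing.div_surjective (A := XS K0 n r) g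
  exact ⟨p, q, nonZeroDivisors.ne_zero hq, h.symm⟩

/-- The quotient rule holds for every representative of a fraction. -/
lemma DX_div (i : Fin n) (p q : XS K0 n r) (hq : q ≠ 0) :
    DX K0 n r i (toF K0 n r p / toF K0 n r q) =
      (toF K0 n r (pderiv (Sum.inl i) p) * toF K0 n r q -
        toF K0 n r p * toF K0 n r (pderiv (Sum.inl i) q)) / toF K0 n r q ^ 2 := by
  unfold DX
  extract_lets h
  have hmem := h.choose_spec.choose_spec.1
  have heq : toF K0 n r h.choose / toF K0 n r h.choose_spec.choose =
    toF K0 n r p / toF K0 n r q := h.choose_spec.choose_spec.2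
  generalize h.choose_spec.choose = v at *
  generalize h.choose = u at *
  have hv : v ≠ 0 := nonZeroDivisors.ne_zero hmem
  have hv' := toF_ne_zero hv
  have hq' := toF_ne_zero hq
  rw [div_eq_div_iff hv' hq', ← toF_mul, ← toF_mul] at heq
  have hX := toF_injective heq
  have hd := congrArg (fun t => toF K0 n r (pderiv (Sum.inl i) t)) hX
  simp only [Derivation.leibniz, smul_eq_mul, toF_add, toF_mul] at hd
  simp only [toF_mul] at heq
  rw [div_eq_div_iff (pow_ne_zero 2 hv') (pow_ne_zero 2 hq')]
  linear_combination (toF K0 n r v * toF K0 n r q) * hd -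
    (toF K0 n r q * toF K0 n r (pderiv (Sum.inl i) v) +
      toF K0 n r v * toF K0 n r (pderiv (Sum.inl i) q)) * heq

lemma DX_toF (i : Fin n) (p : XS K0 n r) :
    DX K0 n r i (toF K0 n r p) = toF K0 n r (pderiv (Sum.inl i) p) := by
  have h := DX_div i p 1 one_ne_zero
  simpa [toF_one, toF_zero] using h

lemma DX_add (i : Fin n) (g h : Frac K0 n r) :
    DX K0 n r i (g + h) = DX K0 n r i g + DX K0 n r i h := by
  obtain ⟨p, q, hq, rfl⟩ := exists_eq_div g
  obtain ⟨u, v, hv, rfl⟩ := exists_eq_div h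
  have hv' := toF_ne_zero hv
  have hq' := toF_ne_zero hq
  rw [div_add_div _ _ hq' hv', ← toF_mul, ← toF_mul, ← toF_mul, ← toF_add,
    DX_div _ _ _ (mul_ne_zero hq hv), DX_div _ _ _ hq, DX_div _ _ _ hv]
  simp only [map_add, Derivation.leibniz, smul_eq_mul, toF_add, toF_mul]
  field_simp
  ring

lemma DX_mul (i : Fin n) (g h : Frac K0 n r) :
    DX K0 n r i (g * h) = DX K0 n r i g * h + g * DX K0 n r i h := by
  obtain ⟨p, q, hq, rfl⟩ := exists_eq_div g
  obtain ⟨u, v, hv, rfl⟩ := exists_eq_div h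
  have hv' := toF_ne_zero hv
  have hq' := toF_ne_zero hq
  rw [div_mul_div_comm, ← toF_mul, ← toF_mul,
    DX_div _ _ _ (mul_ne_zero hq hv), DX_div _ _ _ hq, DX_div _ _ _ hv]
  simp only [Derivation.leibniz, smul_eq_mul, toF_add, toF_mul]
  field_simp
  ring

variable (f : Fin r → MvPolynomial (Fin n) K0)

lemma nabla_add (i : Fin n) (g h : Frac K0 n r) :
    nabla K0 n r f i (g + h) = nabla K0 n r f i g + nabla K0 n r f i h := by
  simp only [nabla, DX_add]
  ring

lemma nabla_zero (i : Fin n) : nabla K0 n r f i 0 = 0 := by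
  simpa using nabla_add f i 0 0

lemma nabla_smul (i : Fin n) (p : XS K0 n r) (g : Frac K0 n r) :
    nabla K0 n r f i (p • g) =
      pderiv (Sum.inl i) p • g + p • nabla K0 n r f i g := by
  have hs : ∀ (u : XS K0 n r) (h : Frac K0 n r), u • h = toF K0 n r u * h :=
    fun u h => Algebra.smul_def u h
  simp only [nabla, hs, DX_mul, DX_toF]
  ring

/-- If `∇` maps a generating set into its span, then the span is stable under `∇`. -/
lemma nabla_mem_span (i : Fin n) {S : Set (Frac K0 n r)}
    (hS : ∀ g ∈ S, nabla K0 n r f i g ∈ Submodule.span (XS K0 n r) S)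
    {g : Frac K0 n r} (hg : g ∈ Submodule.span (XS K0 n r) S) :
    nabla K0 n r f i g ∈ Submodule.span (XS K0 n r) S := by
  induction hg using Submodule.span_induction with
  | mem g hg => exact hS g hg
  | zero => rw [nabla_zero]; exact zero_mem _
  | add g h _ _ ihg ihh => rw [nabla_add]; exact add_mem ihg ihh
  | smul p g hg ih =>
    rw [nabla_smul]
    exact add_mem (Submodule.smul_mem _ _ hg) (Submodule.smul_mem _ _ ih)

lemma pderiv_ps (i : Fin n) (p : MvPolynomial (Fin r) K0) :
    pderiv (Sum.inl i) (ps K0 n r p) = 0 := by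
  classical
  apply pderiv_eq_zero_of_notMem_vars
  intro h
  have := vars_rename (Sum.inr : Fin r → Fin n ⊕ Fin r) p h
  simp at this

end Derivation

section Monomial

variable {r : ℕ}

/-- The linear form `∑ N_j s_j`. -/
def linForm (N : Fin r → ℕ) : MvPolynomial (Fin r) ℂ := ∑ j, C (N j : ℂ) * X j

/-- The product `(σ + m)(σ + m - 1)⋯(σ + m - l + 1)` where `σ = ∑ N_j s_j`. -/
def fallingProd (N : Fin r → ℕ) (m l : ℕ) : MvPolynomial (Fin r) ℂ :=
  ∏ i ∈ Finset.range l, (linForm N + C ((m : ℂ) - i))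

/-- The variable `x` in `ℂ[x, s]`. -/
abbrev xvar (r : ℕ) : XS ℂ 1 r := X (Sum.inl 0)

/-- The iterated derivatives `∇^l (x^m F^s)`. -/
def gen (N : Fin r → ℕ) (m l : ℕ) : Frac ℂ 1 r :=
  toF ℂ 1 r (ps ℂ 1 r (fallingProd N m l)) * toF ℂ 1 r (xvar r ^ m) / toF ℂ 1 r (xvar r ^ l)

lemma fallingProd_self (N : Fin r → ℕ) (m : ℕ) :
    fallingProd N m m =
      ∏ c ∈ Finset.Icc 1 m, ((∑ j, C ((N j : ℂ)) * X j) + C ((c : ℂ))) := by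
  rw [fallingProd, ← Finset.prod_range_reflect, ← Finset.Ico_add_one_right_eq_Icc,
    Finset.prod_Ico_eq_prod_range]
  refine Finset.prod_congr (by simp) fun i hi => ?_
  have hi' : i < m := by simpa using hi
  have : ((m : ℂ) - ((m - 1 - i : ℕ) : ℂ)) = ((1 + i : ℕ) : ℂ) := by
    rw [sub_eq_iff_eq_add]
    norm_cast
    omega
  rw [this, linForm]

lemma fallingProd_self_ne_zero (N : Fin r → ℕ) (m : ℕ) : fallingProd N m m ≠ 0 := by
  rw [fallingProd, Finset.prod_ne_zero_iff]
  intro i hi h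
  have h0 := congrArg (eval 0) h
  simp only [linForm, map_add, map_sum, map_mul, eval_C, eval_X, Pi.zero_apply, mul_zero,
    Finset.sum_const_zero, zero_add, map_zero, sub_eq_zero, Nat.cast_inj] at h0
  simp [h0] at hi

lemma fallingProd_dvd (N : Fin r → ℕ) (m : ℕ) {k l : ℕ} (h : k ≤ l) :
    fallingProd N m k ∣ fallingProd N m l :=
  Finset.prod_dvd_prod_of_subset _ _ _ (Finset.range_subset_range.2 h)

lemma pderiv_xvar_pow_mul (r k : ℕ) :
    toF ℂ 1 r (pderiv (Sum.inl 0) (xvar r ^ k)) * toF ℂ 1 r (xvar r) =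
      k * toF ℂ 1 r (xvar r) ^ k := by
  cases k with
  | zero => simp [toF_zero]
  | succ k =>
    rw [Derivation.leibniz_pow, pderiv_X_self, ← toF_mul, ← toF_pow]
    have : ((k + 1 : ℕ) : Frac ℂ 1 r) = toF ℂ 1 r ((k + 1 : ℕ) : XS ℂ 1 r) :=
      (map_natCast _ _).symm
    rw [this, ← toF_mul]
    congr 1
    simp only [Nat.add_sub_cancel, smul_eq_mul, nsmul_eq_mul]
    ring

lemma toF_xvar_ne_zero (r : ℕ) : toF ℂ 1 r (xvar r) ≠ 0 := toF_ne_zero (X_ne_zero _)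

lemma twist_monomial (N : Fin r → ℕ) :
    twist ℂ 1 r (fun j => X 0 ^ N j) 0 =
      toF ℂ 1 r (ps ℂ 1 r (linForm N)) / toF ℂ 1 r (xvar r) := by
  have hx := toF_xvar_ne_zero r
  have hsum : toF ℂ 1 r (ps ℂ 1 r (linForm N)) =
      ∑ j, (N j : Frac ℂ 1 r) * toF ℂ 1 r (X (Sum.inr j)) := by
    simp [toF, ps, linForm]
  rw [twist, hsum, Finset.sum_div]
  refine Finset.sum_congr rfl fun j _ => ?_
  have hp : px ℂ 1 r (pderiv 0 (X 0 ^ N j)) = pderiv (Sum.inl 0) (xvar r ^ N j) := by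
    simp [px, Derivation.leibniz_pow]
  have hp' : px ℂ 1 r (X 0 ^ N j) = xvar r ^ N j := by simp [px]
  have hd := pderiv_xvar_pow_mul r (N j)
  rw [hp, hp', toF_pow, div_eq_div_iff (pow_ne_zero _ hx) hx]
  linear_combination toF ℂ 1 r (X (Sum.inr j)) * hd

lemma nabla_gen (N : Fin r → ℕ) (m l : ℕ) :
    nabla ℂ 1 r (fun j => X 0 ^ N j) 0 (gen N m l) = gen N m (l + 1) := by
  have hx := toF_xvar_ne_zero r
  have hX : xvar r ^ l ≠ 0 := pow_ne_zero _ (X_ne_zero _)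
  have hm := pderiv_xvar_pow_mul r m
  have hl := pderiv_xvar_pow_mul r l
  have hP : toF ℂ 1 r (ps ℂ 1 r (fallingProd N m (l + 1))) =
      toF ℂ 1 r (ps ℂ 1 r (fallingProd N m l)) *
        (toF ℂ 1 r (ps ℂ 1 r (linForm N)) + m - l) := by
    rw [fallingProd, Finset.prod_range_succ, ← fallingProd]
    simp [toF, ps, add_sub_assoc]
  rw [nabla, twist_monomial, gen, gen, ← toF_mul, DX_div _ _ _ hX, Derivation.leibniz, pderiv_ps,
    smul_zero, add_zero, smul_eq_mul, hP]
  simp only [toF_mul, toF_pow] at hm hl ⊢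
  rw [← eq_div_iff hx] at hm hl
  rw [hm, hl]
  field_simp
  ring

lemma Na_eq_span (N a : Fin r → ℕ) :
    Na ℂ 1 r (fun j => X 0 ^ N j) a =
      Submodule.span (XS ℂ 1 r) (Set.range (gen N (∑ j, N j * a j))) := by
  have hF : Fsa ℂ 1 r (fun j => X 0 ^ N j) a = gen N (∑ j, N j * a j) 0 := by
    simp [Fsa, gen, fallingProd, px, ps, toF, ← pow_mul, Finset.prod_pow_eq_pow_sum]
  apply le_antisymm
  · refine sInf_le ⟨hF ▸ Submodule.subset_span ⟨0, rfl⟩, fun i g hg => ?_⟩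
    refine nabla_mem_span _ i ?_ hg
    rintro _ ⟨l, rfl⟩
    rw [Subsingleton.elim i 0, nabla_gen]
    exact Submodule.subset_span ⟨l + 1, rfl⟩
  · refine le_sInf fun P hP => Submodule.span_le.2 ?_
    rintro _ ⟨l, rfl⟩
    induction l with
    | zero => exact hF ▸ hP.1
    | succ l ih => rw [← nabla_gen]; exact hP.2 0 _ ih

/-- After clearing denominators, an element of the span of the `gen N m l` lies in the ideal
generated by `x^{K+1}` and the product of the first `m` factors. -/
lemma exists_of_mem_span (N : Fin r → ℕ) (m : ℕ) {g : Frac ℂ 1 r}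
    (hg : g ∈ Submodule.span (XS ℂ 1 r) (Set.range (gen N m))) :
    ∃ (K : ℕ) (A B : XS ℂ 1 r), toF ℂ 1 r (xvar r) ^ K * g =
      toF ℂ 1 r (xvar r ^ (K + 1) * A + ps ℂ 1 r (fallingProd N m m) * B) := by
  have hx := toF_xvar_ne_zero r
  induction hg using Submodule.span_induction with
  | mem g hg =>
    obtain ⟨l, rfl⟩ := hg
    rcases lt_or_ge l m with h | h
    · obtain ⟨d, rfl⟩ := Nat.exists_eq_add_of_lt h
      refine ⟨l, ps ℂ 1 r (fallingProd N (l + d + 1) l) * xvar r ^ d, 0, ?_⟩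
      simp only [gen, toF_mul, toF_pow, mul_zero, add_zero]
      field_simp
      ring
    · obtain ⟨Q, hQ⟩ := fallingProd_dvd N m h
      refine ⟨l, 0, ps ℂ 1 r Q * xvar r ^ m, ?_⟩
      have : ps ℂ 1 r (fallingProd N m l) = ps ℂ 1 r (fallingProd N m m) * ps ℂ 1 r Q := by
        rw [hQ]; exact map_mul _ _ _
      simp only [gen, this, toF_mul, toF_pow, mul_zero, zero_add]
      field_simp
  | zero => exact ⟨0, 0, 0, by simp [toF_zero]⟩
  | add g h _ _ ihg ihh =>
    obtain ⟨K, A, B, hK⟩ := ihg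
    obtain ⟨L, A', B', hL⟩ := ihh
    refine ⟨K + L, A + A', xvar r ^ L * B + xvar r ^ K * B', ?_⟩
    simp only [toF_add, toF_mul, toF_pow] at hK hL ⊢
    linear_combination toF ℂ 1 r (xvar r) ^ L * hK + toF ℂ 1 r (xvar r) ^ K * hL
  | smul p g _ ih =>
    obtain ⟨K, A, B, hK⟩ := ih
    refine ⟨K, p * A, p * B, ?_⟩
    rw [show p • g = toF ℂ 1 r p * g from Algebra.smul_def p g]
    simp only [toF_add, toF_mul, toF_pow] at hK ⊢
    linear_combination toF ℂ 1 r p * hK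

/-- The specialization `x = 0`. -/
def specialize (r : ℕ) : XS ℂ 1 r →ₐ[ℂ] MvPolynomial (Fin r) ℂ := aeval (Sum.elim 0 X)

lemma specialize_ps (p : MvPolynomial (Fin r) ℂ) : specialize r (ps ℂ 1 r p) = p := by
  exact (aeval_rename _ _ _).trans (aeval_X_left_apply p)

lemma specialize_xvar : specialize r (xvar r) = 0 := by
  simp [specialize]

lemma dvd_of_toF_mem_span (N : Fin r → ℕ) (m : ℕ) {b : MvPolynomial (Fin r) ℂ}
    (hb : toF ℂ 1 r (ps ℂ 1 r b) ∈ Submodule.span (XS ℂ 1 r) (Set.range (gen N m))) :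
    fallingProd N m m ∣ b := by
  obtain ⟨K, A, B, h⟩ := exists_of_mem_span N m hb
  rw [← toF_pow, ← toF_mul] at h
  have h := toF_injective h
  have hnd : ¬ xvar r ∣ ps ℂ 1 r (fallingProd N m m) := fun hd => by
    have := map_dvd (specialize r) hd
    rw [specialize_ps, specialize_xvar, zero_dvd_iff] at this
    exact fallingProd_self_ne_zero N m this
  have hprime : Prime (xvar r) := X_prime
  have hdvd : xvar r ^ K ∣ ps ℂ 1 r (fallingProd N m m) * B :=
    ⟨ps ℂ 1 r b - xvar r * A, by linear_combination -h⟩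
  obtain ⟨B', rfl⟩ := hprime.pow_dvd_of_dvd_mul_left K hnd hdvd
  have h' : ps ℂ 1 r b = xvar r * A + ps ℂ 1 r (fallingProd N m m) * B' := by
    apply mul_left_cancel₀ (pow_ne_zero K hprime.ne_zero)
    linear_combination h
  have h0 := congrArg (specialize r) h'
  simp only [map_add, map_mul, specialize_ps, specialize_xvar, zero_mul, zero_add] at h0
  exact ⟨_, h0⟩

lemma toF_mem_span_of_dvd (N : Fin r → ℕ) (m : ℕ) {b : MvPolynomial (Fin r) ℂ}
    (hb : fallingProd N m m ∣ b) :
    toF ℂ 1 r (ps ℂ 1 r b) ∈ Submodule.span (XS ℂ 1 r) (Set.range (gen N m)) := by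
  obtain ⟨c, rfl⟩ := hb
  have h : toF ℂ 1 r (ps ℂ 1 r (fallingProd N m m * c)) = ps ℂ 1 r c • gen N m m := by
    rw [show ps ℂ 1 r c • gen N m m = toF ℂ 1 r (ps ℂ 1 r c) * gen N m m from
      Algebra.smul_def _ _, gen, toF_pow,
      mul_div_cancel_right₀ _ (pow_ne_zero m (toF_xvar_ne_zero r)), ← toF_mul, mul_comm]
    exact congrArg _ (map_mul (rename _) _ _)
  rw [h]
  exact Submodule.smul_mem _ _ (Submodule.subset_span ⟨m, rfl⟩)

end Monomial

end BernsteinSato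

open BernsteinSato in
/-- For `n = 1` and `f_j = x^{N_j}` with `m = ∑ N_j a_j > 0`, the Bernstein–Sato ideal `B_F^a`
is the principal ideal generated by `∏_{c=1}^{m} (N₁s₁ + ⋯ + N_r s_r + c)`. -/
theorem stmt2 (r : ℕ) (hr : 1 ≤ r) (N : Fin r → ℕ) (a : Fin r → ℕ)
    (m : ℕ) (hm : m = ∑ j, N j * a j) (hm0 : 0 < m) :
    BS ℂ 1 r (fun j => X 0 ^ N j) a =
      ↑(Ideal.span {∏ c ∈ Finset.Icc 1 m,
          ((∑ j, C ((N j : ℂ)) * X j) + C ((c : ℂ)))} :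
        Ideal (MvPolynomial (Fin r) ℂ)) := by
  rw [← fallingProd_self]
  ext b
  rw [SetLike.mem_coe, Ideal.mem_span_singleton]
  change toF ℂ 1 r (ps ℂ 1 r b) ∈ Na ℂ 1 r _ a ↔ _
  rw [Na_eq_span, ← hm]
  exact ⟨dvd_of_toF_mem_span N m, toF_mem_span_of_dvd N m⟩

end
end
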